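/- arXiv:2411.17577 — 3 statements merged into one kernel-verified Lean document; each statement's English description precedes it below -/
import Mathlib

section
/- Let q ∈ (0,1) be fixed with q ≠ 1/2. Then P_q^+(n) ∼ ∑_{k=0}^{n/p(n)} φ_q(k, n/p(n))^{p(n)} as n → ∞ over integers n ≥ 2, where p(n) denotes the smallest prime divisor of n. -/
open Finset

/-- The binomial probability mass function. -/
noncomputable def phi (q : ℝ) (k n : ℕ) : ℝ :=
  (n.choose k : ℝ) * q ^ k * (1 - q) ^ (n - k)

/-- The Bernoulli(q) probability weight of an outcome `c : Fin n → Bool`. -/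
noncomputable def bernWeight (q : ℝ) (n : ℕ) (c : Fin n → Bool) : ℝ :=
  q ^ (Finset.univ.filter (fun j => c j = true)).card *
    (1 - q) ^ (n - (Finset.univ.filter (fun j => c j = true)).card)

/-- Singularity probability of an `n × n` circulant signed Bernoulli(q) matrix (±1 entries). -/
noncomputable def PqPlus (q : ℝ) (n : ℕ) : ℝ :=
  ∑ c : Fin n → Bool,
    if (Matrix.of fun i j : Fin n => (if c (j - i) then (1 : ℚ) else -1)).det = 0 then
      bernWeight q n c
    else 0

noncomputable def zt (d : ℕ) : ℂ := Complex.exp (2 * Real.pi * Complex.I / d)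

def Ev (n : ℕ) (z : ℂ) (c : Fin n → Bool) : Prop :=
  ∑ j : Fin n, (if c j then (1:ℂ) else -1) * z ^ (j : ℕ) = 0

lemma zt_prim {d : ℕ} (hd : d ≠ 0) : IsPrimitiveRoot (zt d) d :=
  Complex.isPrimitiveRoot_exp d hd

lemma circ_mul (n : ℕ) [NeZero n] (v : Fin n → ℂ) (w : ℂ) (hw : w ^ n = 1) (i : Fin n) :
    ∑ j : Fin n, v (j - i) * w ^ (j : ℕ) = w ^ (i : ℕ) * ∑ j : Fin n, v j * w ^ (j : ℕ) := by
  rw [← Equiv.sum_comp (Equiv.addRight i) (fun j => v (j - i) * w ^ (j : ℕ)), Finset.mul_sum]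
  refine Finset.sum_congr rfl fun j _ => ?_
  simp only [Equiv.coe_addRight, add_sub_cancel_right]
  rw [Fin.val_add, ← pow_mod_eq' w hw]
  ring
where
  pow_mod_eq' (w : ℂ) (hw : w ^ n = 1) {k : ℕ} : w ^ k = w ^ (k % n) := by
    conv_lhs => rw [← Nat.div_add_mod k n, pow_add, pow_mul, hw, one_pow, one_mul]

lemma det_iff (n : ℕ) (hn : n ≠ 0) (c : Fin n → Bool) :
    (Matrix.of fun i j : Fin n => (if c (j - i) then (1 : ℚ) else -1)).det = 0 ↔
      ∃ k : Fin n, Ev n (zt n ^ (k : ℕ)) c := by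
  have : NeZero n := ⟨hn⟩
  have hp := zt_prim hn
  set A : Matrix (Fin n) (Fin n) ℂ :=
    Matrix.of fun i j : Fin n => (if c (j - i) then (1 : ℂ) else -1) with hA
  set B : Matrix (Fin n) (Fin n) ℚ :=
    Matrix.of fun i j : Fin n => (if c (j - i) then (1 : ℚ) else -1) with hB
  have hmap : A = (algebraMap ℚ ℂ).mapMatrix B := by
    ext i j
    simp only [hA, hB, Matrix.of_apply, RingHom.mapMatrix_apply, Matrix.map_apply]
    split_ifs <;> simp
  have hdet : A.det = algebraMap ℚ ℂ B.det := by
    rw [hmap, ← RingHom.map_det]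
  let V : Matrix (Fin n) (Fin n) ℂ := Matrix.vandermonde (fun k : Fin n => zt n ^ (k : ℕ))
  have hV : V.det ≠ 0 := by
    rw [Matrix.det_vandermonde_ne_zero_iff]
    intro i j h
    exact Fin.ext (hp.pow_inj i.2 j.2 h)
  have hmul : A * V = V * Matrix.diagonal
      (fun k : Fin n => ∑ j : Fin n, (if c j then (1:ℂ) else -1) * (zt n ^ (k : ℕ)) ^ (j : ℕ)) := by
    ext i k
    rw [Matrix.mul_diagonal, Matrix.mul_apply]
    have h1 : (zt n ^ (k : ℕ)) ^ n = 1 := by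
      rw [← pow_mul, mul_comm, pow_mul, hp.pow_eq_one, one_pow]
    have := circ_mul n (fun j => if c j then (1:ℂ) else -1) (zt n ^ (k : ℕ)) h1 i
    simp only [V, hA, Matrix.of_apply, Matrix.vandermonde_apply]
    have e : ∀ a b : ℕ, (zt n ^ a) ^ b = (zt n ^ b) ^ a := fun a b => by
      rw [← pow_mul, ← pow_mul, mul_comm]
    rw [e i k, ← this]
    exact Finset.sum_congr rfl fun j _ => by rw [e j k]
  have h2 : A.det = ∏ k : Fin n, ∑ j : Fin n, (if c j then (1:ℂ) else -1) * (zt n ^ (k : ℕ)) ^ (j : ℕ) := by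
    have := congrArg Matrix.det hmul
    rw [Matrix.det_mul, Matrix.det_mul, Matrix.det_diagonal, mul_comm] at this
    exact mul_left_cancel₀ hV this
  have h3 : B.det = 0 ↔ A.det = 0 := by
    rw [hdet]; simp
  rw [h3, h2, Finset.prod_eq_zero_iff]
  simp [Ev]

lemma Ev_conj {n d : ℕ} (hd : 0 < d) {z z' : ℂ} (hz : IsPrimitiveRoot z d)
    (hz' : IsPrimitiveRoot z' d) (c : Fin n → Bool) (h : Ev n z c) : Ev n z' c := by
  let f : Polynomial ℚ := ∑ j : Fin n,
    Polynomial.C (if c j then (1:ℚ) else -1) * Polynomial.X ^ (j : ℕ)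
  have hf : ∀ w : ℂ, Polynomial.aeval w f =
      ∑ j : Fin n, (if c j then (1:ℂ) else -1) * w ^ (j : ℕ) := by
    intro w
    simp only [f, map_sum, map_mul, map_pow, Polynomial.aeval_X, Polynomial.aeval_C]
    refine Finset.sum_congr rfl fun j _ => ?_
    split_ifs <;> simp
  unfold Ev at *
  rw [← hf] at *
  have h1 := minpoly.dvd ℚ z h
  rw [← Polynomial.cyclotomic_eq_minpoly_rat hz hd, 
    Polynomial.cyclotomic_eq_minpoly_rat hz' hd] at h1
  obtain ⟨g, hg⟩ := h1
  rw [hg, map_mul, minpoly.aeval, zero_mul]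

lemma det_iff' (n : ℕ) (hn : n ≠ 0) (c : Fin n → Bool) :
    (Matrix.of fun i j : Fin n => (if c (j - i) then (1 : ℚ) else -1)).det = 0 ↔
      ∃ d ∈ n.divisors, Ev n (zt d) c := by
  have : NeZero n := ⟨hn⟩
  rw [det_iff n hn c]
  constructor
  · rintro ⟨k, hk⟩
    have h1 : (zt n ^ (k : ℕ)) ^ n = 1 := by
      rw [← pow_mul, mul_comm, pow_mul, (zt_prim hn).pow_eq_one, one_pow]
    have hdv : orderOf (zt n ^ (k : ℕ)) ∣ n := orderOf_dvd_of_pow_eq_one h1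
    have hpos := Nat.pos_of_dvd_of_pos hdv (Nat.pos_of_ne_zero hn)
    exact ⟨_, Nat.mem_divisors.2 ⟨hdv, hn⟩, Ev_conj hpos (IsPrimitiveRoot.orderOf _)
      (zt_prim hpos.ne') c hk⟩
  · rintro ⟨d, hd, h⟩
    rw [Nat.mem_divisors] at hd
    have hd0 : d ≠ 0 := fun h0 => hn (by simpa [h0] using hd.1)
    have h1 : zt d ^ n = 1 := by
      obtain ⟨a, rfl⟩ := hd.1
      rw [pow_mul, (zt_prim hd0).pow_eq_one, one_pow]
    obtain ⟨i, hi, h2⟩ := (zt_prim hn).eq_pow_of_pow_eq_one h1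
    exact ⟨⟨i, hi⟩, by simpa [h2] using h⟩
lemma phi_nonneg {q : ℝ} (h0 : 0 < q) (h1 : q < 1) (k m : ℕ) : 0 ≤ phi q k m := by
  unfold phi
  have : 0 < 1 - q := by linarith
  positivity

lemma phi_pos {q : ℝ} (h0 : 0 < q) (h1 : q < 1) {k m : ℕ} (hk : k ≤ m) : 0 < phi q k m := by
  unfold phi
  have : 0 < 1 - q := by linarith
  have := Nat.choose_pos hk
  positivity

lemma phi_zero (q : ℝ) {k m : ℕ} (hk : m < k) : phi q k m = 0 := by
  simp [phi, Nat.choose_eq_zero_of_lt hk]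

lemma phi_sum (q : ℝ) (m : ℕ) : ∑ k ∈ range (m + 1), phi q k m = 1 := by
  have := add_pow q (1 - q) m
  rw [add_sub_cancel, one_pow] at this
  rw [this]
  exact Finset.sum_congr rfl fun k _ => by unfold phi; ring

lemma phi_step (q : ℝ) {k m : ℕ} :
    phi q (k + 1) m * ((k + 1) * (1 - q)) = phi q k m * (((m : ℝ) - k) * q) := by
  rcases lt_or_ge k m with h | h
  · obtain ⟨r, rfl⟩ := Nat.exists_eq_add_of_lt h
    have := Nat.choose_succ_right_eq (k + r + 1) k
    have e : k + r + 1 - k = r + 1 := by omega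
    rw [e] at this
    have this' : (((k + r + 1).choose (k + 1) : ℕ) : ℝ) * (k + 1) =
      ((k + r + 1).choose k : ℕ) * (r + 1) := by exact_mod_cast this
    unfold phi
    rw [e, show k + r + 1 - (k + 1) = r by omega]
    push_cast
    calc _ = (((k + r + 1).choose (k + 1) : ℕ) : ℝ) * (k + 1) * (q ^ (k + 1) * (1 - q) ^ (r + 1)) := by ring
      _ = _ := by rw [this']; ring
  · rw [phi_zero q (show m < k + 1 by omega)]
    rcases h.eq_or_lt with h | h
    · subst h; simp
    · rw [phi_zero q h]; simp

lemma phi_up (q : ℝ) (k m : ℕ) :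
    phi q (k + 1) (m + 1) * (k + 1) = phi q k m * ((m + 1) * q) := by
  have := Nat.add_one_mul_choose_eq m k
  have this' : ((m : ℝ) + 1) * (m.choose k : ℕ) = ((m + 1).choose (k + 1) : ℕ) * (k + 1) := by
    exact_mod_cast this
  unfold phi
  rw [show m + 1 - (k + 1) = m - k by omega]
  calc _ = (((m + 1).choose (k + 1) : ℕ) * (k + 1) : ℝ) * (q ^ (k + 1) * (1 - q) ^ (m - k)) := by ring
    _ = _ := by rw [← this']; ring

lemma phi_pascal (q : ℝ) (k m : ℕ) :
    phi q (k + 1) (m + 1) = q * phi q k m + (1 - q) * phi q (k + 1) m := by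
  unfold phi
  rw [show m + 1 - (k + 1) = m - k by omega, Nat.choose_succ_succ]
  push_cast
  rcases lt_or_ge k m with h | h
  · rw [show m - k = (m - (k + 1)) + 1 by omega]; ring
  · rw [Nat.choose_eq_zero_of_lt (show m < k + 1 by omega)]; simp; ring

noncomputable def Mx (q : ℝ) (m : ℕ) : ℝ :=
  (range (m + 1)).sup' ⟨0, by simp⟩ (fun k => phi q k m)

section
variable {q : ℝ} (h0 : 0 < q) (h1 : q < 1)

lemma exists_mode (q : ℝ) (m : ℕ) : ∃ k ≤ m, Mx q m = phi q k m := by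
  obtain ⟨k, hk, h⟩ := Finset.exists_mem_eq_sup' (s := range (m + 1)) ⟨0, by simp⟩ (fun k => phi q k m)
  exact ⟨k, by simpa [Nat.lt_succ_iff] using hk, h⟩

include h0 h1

lemma Mx_pos (m : ℕ) : 0 < Mx q m := by
  obtain ⟨k, hk, h⟩ := exists_mode q m
  rw [h]; exact phi_pos h0 h1 hk

lemma phi_le_Mx (k m : ℕ) : phi q k m ≤ Mx q m := by
  rcases le_or_gt k m with h | h
  · exact Finset.le_sup' (fun k => phi q k m) (by simp; omega)
  · rw [phi_zero q h]; exact (Mx_pos h0 h1 m).le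

lemma Mx_ge (m : ℕ) : 1 / ((m : ℝ) + 1) ≤ Mx q m := by
  have : ∑ k ∈ range (m + 1), phi q k m ≤ ∑ k ∈ range (m + 1), Mx q m :=
    Finset.sum_le_sum fun k _ => phi_le_Mx h0 h1 k m
  rw [phi_sum] at this
  simp at this
  rw [div_le_iff₀ (by positivity)]
  linarith

lemma mode_spec (m : ℕ) : ∃ k ≤ m, Mx q m = phi q k m ∧ (k : ℝ) ≤ (m + 1) * q ∧ (m + 1) * q ≤ k + 1 := by
  obtain ⟨k, hk, h⟩ := exists_mode q m
  have hp := phi_pos h0 h1 hk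
  refine ⟨k, hk, h, ?_, ?_⟩
  · rcases k with _ | k
    · simp; positivity
    · have h2 := phi_le_Mx h0 h1 k m
      rw [h] at h2
      have h3 := phi_step q (k := k) (m := m)
      have h4 : phi q (k+1) m * ((k + 1) * (1 - q)) ≤ phi q (k+1) m * (((m : ℝ) - k) * q) := by
        rw [h3]
        have : (k : ℝ) + 1 ≤ m := by exact_mod_cast hk
        have : 0 ≤ ((m : ℝ) - k) * q := mul_nonneg (by linarith) h0.le
        gcongr
      have := le_of_mul_le_mul_left h4 hp
      push_cast
      linarith
  · have h2 := phi_le_Mx h0 h1 (k + 1) m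
    rw [h] at h2
    have h3 := phi_step q (k := k) (m := m)
    have h4 : phi q k m * (((m : ℝ) - k) * q) ≤ phi q k m * ((k + 1) * (1 - q)) := by
      rw [← h3]
      have : 0 ≤ ((k : ℝ) + 1) * (1 - q) := mul_nonneg (by positivity) (by linarith)
      gcongr
    have := le_of_mul_le_mul_left h4 hp
    linarith

lemma Mx_anti : Antitone (Mx q) := by
  refine antitone_nat_of_succ_le fun m => ?_
  obtain ⟨k, hk, h⟩ := exists_mode q (m + 1)
  rw [h]
  rcases k with _ | k
  · have := phi_le_Mx h0 h1 0 m
    have h2 : phi q 0 (m + 1) = (1 - q) * phi q 0 m := by simp [phi, pow_succ]; ring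
    have := phi_nonneg h0 h1 0 m
    rw [h2]; nlinarith
  · rw [phi_pascal]
    have := phi_le_Mx h0 h1 k m
    have := phi_le_Mx h0 h1 (k+1) m
    nlinarith

lemma Mx_le_one (m : ℕ) : Mx q m ≤ 1 := by
  have h := Mx_anti h0 h1 (Nat.zero_le m)
  have : Mx q 0 = 1 := by simp [Mx, phi]
  linarith

lemma Mx_one_lt : Mx q 1 < 1 := by
  obtain ⟨k, hk, h⟩ := exists_mode q 1
  rw [h]
  interval_cases k <;> simp [phi] <;> linarith

/-- growth -/
lemma Mx_grow {C : ℕ} (hC : 1 / q ≤ C) {a b : ℕ} (ha : 0 < a) (hab : a ≤ b) :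
    Mx q a ≤ Mx q b * ((b : ℝ) / a) ^ C := by
  have mono : Monotone (fun m : ℕ => ((m : ℝ) + 1) ^ C * Mx q m) := by
    refine monotone_nat_of_le_succ fun m => ?_
    obtain ⟨k, hk, h, h2, h3⟩ := mode_spec h0 h1 m
    have h4 := phi_le_Mx h0 h1 (k + 1) (m + 1)
    have h5 := phi_up q k m
    rw [← h] at h5
    have hM := Mx_pos h0 h1 m
    have h6 : Mx q m * (m + 1) * q ≤ Mx q (m + 1) * ((m + 1) * q + 1) := by
      have : phi q (k + 1) (m + 1) * (k + 1) ≤ Mx q (m + 1) * ((m + 1) * q + 1) := by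
        have := (Mx_pos h0 h1 (m+1)).le
        gcongr
      linarith
    have h7 : Mx q m ≤ Mx q (m + 1) * (1 + C / (m + 1)) := by
      have e : Mx q m ≤ Mx q (m + 1) * (1 + (1 / q) / (m + 1)) := by
        have : Mx q (m + 1) * (1 + (1 / q) / (m + 1)) = Mx q (m + 1) * ((m + 1) * q + 1) / ((m+1) * q) := by
          field_simp
        rw [this, le_div_iff₀ (by positivity)]
        linarith
      refine e.trans ?_
      have := (Mx_pos h0 h1 (m+1)).le
      gcongr
    have h8 : 1 + (C : ℝ) * (1 / (m + 1)) ≤ (1 + 1 / ((m : ℝ) + 1)) ^ C :=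
      one_add_mul_le_pow (by have : (0:ℝ) ≤ 1 / ((m:ℝ)+1) := by positivity
                             linarith) C
    have h9 : ((m : ℝ) + 1) ^ C * (1 + 1 / ((m : ℝ) + 1)) ^ C = (((m + 1 : ℕ) : ℝ) + 1) ^ C := by
      rw [← mul_pow]; congr 1; push_cast; field_simp
    calc ((m : ℝ) + 1) ^ C * Mx q m ≤ ((m : ℝ) + 1) ^ C * (Mx q (m + 1) * (1 + 1 / ((m : ℝ) + 1)) ^ C) := by
          have := (Mx_pos h0 h1 (m+1)).le
          gcongr
          refine h7.trans ?_
          gcongr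
          rw [mul_one_div] at h8; exact h8
      _ = _ := by rw [← h9]; ring
  have h := mono hab
  simp only at h
  have ha' : (0:ℝ) < a := by exact_mod_cast ha
  have hab' : (a:ℝ) ≤ b := by exact_mod_cast hab
  have e : Mx q a ≤ Mx q b * (((b : ℝ) + 1) / (a + 1)) ^ C := by
    rw [div_pow, mul_div_assoc', le_div_iff₀ (by positivity)]
    linarith
  refine e.trans ?_
  have := (Mx_pos h0 h1 b).le
  have : ((b : ℝ) + 1) / (a + 1) ≤ b / a := by
    rw [div_le_div_iff₀ (by positivity) ha']; nlinarith
  gcongr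

lemma flat (j : ℕ) : ∀ δ < (1:ℝ), 0 < δ → ∀ᶠ m : ℕ in Filter.atTop,
    ∀ k : ℕ, Mx q m = phi q k m → (k : ℝ) ≤ (m + 1) * q → δ * Mx q m ≤ phi q (k + j) m := by
  induction j with
  | zero =>
    intro δ hδ hp
    refine Filter.Eventually.of_forall fun m k hk _ => ?_
    rw [add_zero, ← hk]
    have := Mx_pos h0 h1 m
    nlinarith
  | succ j ih =>
    intro δ hδ hp
    -- δ' with δ < δ' < 1
    set δ' := (1 + δ) / 2 with hδ'
    have a1 : δ' < 1 := by rw [hδ']; linarith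
    have a2 : 0 < δ' := by rw [hδ']; linarith
    have a3 : δ / δ' < 1 := by rw [div_lt_one a2]; linarith
    have a4 : 0 < δ / δ' := by positivity
    set r := δ / δ' with hr
    -- eventually r * ((m+1) q + j + 1)(1-q) ≤ (m - (m+1) q - j) q
    have ev : ∀ᶠ m : ℕ in Filter.atTop,
        r * (((m + 1) * q + j + 1) * (1 - q)) ≤ ((m : ℝ) - (m + 1) * q - j) * q := by
      have hc : 0 < (1 - r) * (q * (1 - q)) :=
        mul_pos (by linarith) (mul_pos h0 (by linarith))
      filter_upwards [Filter.Tendsto.eventually_ge_atTop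
        ((tendsto_natCast_atTop_atTop (R := ℝ)).const_mul_atTop hc)
        (r * ((q + j + 1) * (1 - q)) + (q + j) * q)] with m hm
      nlinarith
    filter_upwards [ih δ' a1 a2, ev] with m hm hev k hk hk2
    have b1 := hm k hk hk2
    have hM := Mx_pos h0 h1 m
    have b2 := phi_step q (k := k + j) (m := m)
    have hq' : 0 < 1 - q := by linarith
    have hden : 0 < ((k + j : ℕ) + 1 : ℝ) * (1 - q) := by positivity
    have b3 : r * (((k + j : ℕ) + 1 : ℝ) * (1 - q)) ≤ ((m : ℝ) - (k + j : ℕ)) * q := by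
      push_cast
      calc r * (((k:ℝ) + j + 1) * (1 - q)) ≤ r * (((m + 1) * q + j + 1) * (1 - q)) := by gcongr
        _ ≤ _ := hev
        _ ≤ _ := by
          apply mul_le_mul_of_nonneg_right _ h0.le
          linarith
    have b4 : (δ * Mx q m) * (((k + j : ℕ) + 1 : ℝ) * (1 - q)) ≤
        phi q (k + j + 1) m * (((k + j : ℕ) + 1 : ℝ) * (1 - q)) := by
      rw [b2]
      calc _ = (δ' * Mx q m) * (r * (((k + j : ℕ) + 1 : ℝ) * (1 - q))) := by
            rw [hr]; field_simp
        _ ≤ phi q (k + j) m * (((m : ℝ) - (k + j : ℕ)) * q) := by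
            apply mul_le_mul b1 b3 (by positivity) (phi_nonneg h0 h1 _ _)
    exact le_of_mul_le_mul_right b4 hden

lemma flat_sum (K : ℕ) : ∀ᶠ m : ℕ in Filter.atTop, ∀ p : ℕ, 1 ≤ p →
    K * (Mx q m / 2) ^ p ≤ ∑ k ∈ range (m + 1), phi q k m ^ p := by
  have h : ∀ᶠ m : ℕ in Filter.atTop, ∀ j ∈ range K, ∀ k : ℕ, Mx q m = phi q k m →
      (k : ℝ) ≤ (m + 1) * q → (1/2) * Mx q m ≤ phi q (k + j) m :=
    (Filter.eventually_all_finset _).2 fun j _ => flat h0 h1 j (1/2) (by norm_num) (by norm_num)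
  filter_upwards [h] with m hm p hp
  obtain ⟨k, hk, e, h2, h3⟩ := mode_spec h0 h1 m
  have hM := Mx_pos h0 h1 m
  have b : ∀ j ∈ range K, Mx q m / 2 ≤ phi q (k + j) m := fun j hj => by
    have := hm j hj k e h2; linarith
  calc K * (Mx q m / 2) ^ p = ∑ j ∈ range K, (Mx q m / 2) ^ p := by simp
    _ ≤ ∑ j ∈ range K, phi q (k + j) m ^ p := 
      Finset.sum_le_sum fun j hj => pow_le_pow_left₀ (by positivity) (b j hj) p
    _ = ∑ i ∈ (range K).map (addLeftEmbedding k), phi q i m ^ p := by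
      rw [Finset.sum_map]; rfl
    _ ≤ _ := by
      apply Finset.sum_le_sum_of_subset_of_nonneg
      · intro i hi
        simp only [Finset.mem_map, addLeftEmbedding_apply] at hi
        obtain ⟨j, hj, rfl⟩ := hi
        by_contra hc
        have := b j hj
        rw [phi_zero q (by simpa [Nat.lt_succ_iff] using hc)] at this
        linarith
      · intro i _ _
        exact pow_nonneg (phi_nonneg h0 h1 _ _) _

lemma Mx_tendsto : Filter.Tendsto (Mx q) Filter.atTop (nhds 0) := by
  rw [Metric.tendsto_atTop']
  intro ε hε
  obtain ⟨K, hK⟩ := exists_nat_gt (2 / ε)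
  obtain ⟨N, hN⟩ := Filter.eventually_atTop.1 (flat_sum h0 h1 K)
  refine ⟨N, fun m hm => ?_⟩
  have h := hN m hm.le 1 le_rfl
  simp only [pow_one, phi_sum] at h
  have hM := Mx_pos h0 h1 m
  rw [Real.dist_eq, sub_zero, abs_of_pos hM]
  rw [div_lt_iff₀ hε] at hK
  by_contra hc
  push Not at hc
  have : (K:ℝ) * ε ≤ K * Mx q m := by gcongr
  linarith

lemma S_ge (m p : ℕ) : Mx q m ^ p ≤ ∑ k ∈ range (m + 1), phi q k m ^ p := by
  obtain ⟨k, hk, e⟩ := exists_mode q m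
  rw [e]
  exact Finset.single_le_sum (f := fun k => phi q k m ^ p)
    (fun i _ => pow_nonneg (phi_nonneg h0 h1 _ _) _) (by simp; omega)

end
noncomputable def cnt {a : ℕ} (c : Fin a → Bool) : ℕ :=
  (Finset.univ.filter (fun j => c j = true)).card

noncomputable def wt (q : ℝ) (b : Bool) : ℝ := if b then q else 1 - q

lemma cnt_le {a : ℕ} (c : Fin a → Bool) : cnt c ≤ a := by
  have := Finset.card_filter_le (Finset.univ : Finset (Fin a)) (fun j => c j = true)
  simpa [cnt] using this

lemma bern_eq_prod (q : ℝ) (n : ℕ) (c : Fin n → Bool) :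
    bernWeight q n c = ∏ j, wt q (c j) := by
  unfold wt bernWeight
  rw [Finset.prod_ite, Finset.prod_const, Finset.prod_const]
  congr 2
  have := Finset.card_filter_add_card_filter_not (s := (Finset.univ : Finset (Fin n))) (fun j => c j = true)
  simp only [Finset.card_univ, Fintype.card_fin] at this
  omega

lemma bern_nonneg {q : ℝ} (h0 : 0 < q) (h1 : q < 1) (n : ℕ) (c : Fin n → Bool) :
    0 ≤ bernWeight q n c := by
  unfold bernWeight
  have : 0 < 1 - q := by linarith
  positivity

lemma sum_cnt (q : ℝ) (a k : ℕ) :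
    ∑ c : Fin a → Bool, (if cnt c = k then bernWeight q a c else 0) = phi q k a := by
  have h : ∀ c : Fin a → Bool, (if cnt c = k then bernWeight q a c else 0) =
      if cnt c = k then q ^ k * (1 - q) ^ (a - k) else 0 := by
    intro c
    split_ifs with h
    · unfold bernWeight; rw [show (Finset.univ.filter (fun j => c j = true)).card = k from h]
    · rfl
  rw [Finset.sum_congr rfl fun c _ => h c, ← Finset.sum_filter, Finset.sum_const]
  have : (Finset.univ.filter (fun c : Fin a → Bool => cnt c = k)).card = a.choose k := by
    have e := Finset.card_powersetCard k (Finset.univ : Finset (Fin a))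
    rw [Finset.card_univ, Fintype.card_fin] at e
    rw [← e]
    refine Finset.card_bij' (fun c _ => Finset.univ.filter (fun j => c j = true))
      (fun s _ j => decide (j ∈ s)) ?_ ?_ ?_ ?_
    · intro c hc
      rw [Finset.mem_filter] at hc
      rw [Finset.mem_powersetCard]
      exact ⟨Finset.subset_univ _, hc.2⟩
    · intro s hs
      rw [Finset.mem_powersetCard] at hs
      rw [Finset.mem_filter]
      refine ⟨Finset.mem_univ _, ?_⟩
      simpa [cnt] using hs.2
    · intro c _; ext j; simp
    · intro s _; ext j; simp
  rw [this, nsmul_eq_mul]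
  unfold phi; ring

open Classical in
lemma push (q : ℝ) (a d : ℕ) (F : (Fin d → ℕ) → Prop) :
    ∑ c : Fin (a * d) → Bool,
      (if F (fun i => cnt (fun l => c (finProdFinEquiv (l, i)))) then bernWeight q (a * d) c else 0) =
    ∑ s ∈ Fintype.piFinset (fun _ : Fin d => range (a + 1)), 
      if F s then ∏ i, phi q (s i) a else 0 := by
  let e : (Fin (a * d) → Bool) ≃ (Fin d → Fin a → Bool) :=
    ((finProdFinEquiv (m := a) (n := d)).symm.arrowCongr (Equiv.refl Bool)).trans
      (((Equiv.prodComm (Fin a) (Fin d)).arrowCongr (Equiv.refl Bool)).trans (Equiv.curry _ _ _))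
  have he : ∀ c i l, e c i l = c (finProdFinEquiv (l, i)) := fun c i l => rfl
  have h1 : ∀ c : Fin (a * d) → Bool, bernWeight q (a * d) c = ∏ i, bernWeight q a (e c i) := by
    intro c
    simp only [bern_eq_prod, he]
    rw [← Equiv.prod_comp finProdFinEquiv, Fintype.prod_prod_type, Finset.prod_comm]
  have h2 : ∑ c : Fin (a * d) → Bool,
      (if F (fun i => cnt (fun l => c (finProdFinEquiv (l, i)))) then bernWeight q (a * d) c else 0) =
      ∑ C : Fin d → Fin a → Bool, if F (fun i => cnt (C i)) then ∏ i, bernWeight q a (C i) else 0 := by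
    rw [← Equiv.sum_comp e]
    refine Finset.sum_congr rfl fun c _ => ?_
    rw [h1]; rfl
  rw [h2]
  have h3 : ∀ s : Fin d → ℕ, ∏ i, phi q (s i) a =
      ∑ C : Fin d → Fin a → Bool, if (fun i => cnt (C i)) = s then ∏ i, bernWeight q a (C i) else 0 := by
    intro s
    simp only [← sum_cnt]
    rw [Finset.prod_univ_sum, Fintype.piFinset_univ]
    refine Finset.sum_congr rfl fun C _ => ?_
    rw [Finset.prod_ite_zero]
    simp [funext_iff]
  simp only [h3]
  have h4 : ∀ s : Fin d → ℕ, (if F s then 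
      ∑ C : Fin d → Fin a → Bool, (if (fun i => cnt (C i)) = s then ∏ i, bernWeight q a (C i) else 0) else 0)
      = ∑ C : Fin d → Fin a → Bool, (if (fun i => cnt (C i)) = s then 
        (if F (fun i => cnt (C i)) then ∏ i, bernWeight q a (C i) else 0) else 0) := by
    intro s
    split_ifs with h
    · refine Finset.sum_congr rfl fun C _ => ?_
      split_ifs with h5 h6 <;> first | rfl | (exfalso; apply h6; rw [h5]; exact h)
    · symm
      apply Finset.sum_eq_zero
      intro C _
      split_ifs with h5 h6 <;> first | rfl | (exfalso; apply h; rw [← h5]; exact h6)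
  simp only [h4]
  rw [Finset.sum_comm]
  refine Finset.sum_congr rfl fun C _ => ?_
  rw [Finset.sum_ite_eq]
  have hm : (fun i => cnt (C i)) ∈ Fintype.piFinset (fun _ : Fin d => range (a + 1)) := by
    simp [cnt_le, Nat.lt_succ_iff]
  rw [if_pos hm]

lemma geom_zero {d : ℕ} (hd : 1 < d) : ∑ i : Fin d, zt d ^ (i : ℕ) = 0 := by
  rw [Fin.sum_univ_eq_sum_range (fun i => zt d ^ i) d]
  exact (zt_prim (by omega)).geom_sum_eq_zero hd

lemma Ev_iff {a d : ℕ} (hd : 1 < d) (c : Fin (a * d) → Bool) :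
    Ev (a * d) (zt d) c ↔
      ∑ i : Fin d, ((cnt (fun l => c (finProdFinEquiv (l, i))) : ℕ) : ℂ) * zt d ^ (i : ℕ) = 0 := by
  unfold Ev
  rw [← Equiv.sum_comp finProdFinEquiv, Fintype.sum_prod_type, Finset.sum_comm]
  have hz := (zt_prim (show d ≠ 0 by omega)).pow_eq_one
  have h : ∀ i : Fin d, ∑ l : Fin a, (if c (finProdFinEquiv (l, i)) then (1:ℂ) else -1) *
      zt d ^ ((finProdFinEquiv (l, i) : Fin (a * d)) : ℕ) =
      2 * (((cnt (fun l => c (finProdFinEquiv (l, i))) : ℕ) : ℂ) * zt d ^ (i : ℕ)) - a * zt d ^ (i : ℕ) := by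
    intro i
    have h1 : ∀ l : Fin a, zt d ^ ((finProdFinEquiv (l, i) : Fin (a * d)) : ℕ) = zt d ^ (i : ℕ) := by
      intro l
      rw [finProdFinEquiv_apply_val, pow_add, pow_mul, hz, one_pow, mul_one]
    simp only [h1]
    rw [← Finset.sum_mul]
    have h2 : ∀ l : Fin a, (if c (finProdFinEquiv (l, i)) then (1:ℂ) else -1) =
      2 * (if c (finProdFinEquiv (l, i)) then (1:ℂ) else 0) - 1 := by
      intro l; split_ifs <;> norm_num
    simp only [h2]
    rw [Finset.sum_sub_distrib, ← Finset.mul_sum, Finset.sum_boole]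
    simp [cnt]; ring
  rw [Finset.sum_congr rfl fun i _ => h i, Finset.sum_sub_distrib, ← Finset.mul_sum, ← Finset.mul_sum,
    geom_zero hd]
  simp

lemma uniq {d : ℕ} (hd : 1 < d) (s t : Fin d → ℕ)
    (hs : ∑ i : Fin d, (s i : ℂ) * zt d ^ (i : ℕ) = 0)
    (ht : ∑ i : Fin d, (t i : ℂ) * zt d ^ (i : ℕ) = 0)
    (h : ∀ i : Fin d, d.totient ≤ (i : ℕ) → s i = t i) : s = t := by
  let f : Polynomial ℚ := ∑ i : Fin d,
    Polynomial.C ((s i : ℚ) - t i) * Polynomial.X ^ (i : ℕ)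
  have hf : Polynomial.aeval (zt d) f = 0 := by
    simp only [f, map_sum, map_mul, map_pow, Polynomial.aeval_X, Polynomial.aeval_C, map_sub,
      map_natCast, sub_mul, Finset.sum_sub_distrib]
    rw [hs, ht, sub_zero]
  have hco : ∀ i : Fin d, f.coeff i = (s i : ℚ) - t i := by
    intro i
    simp only [f, Polynomial.finsetSum_coeff, Polynomial.coeff_C_mul, Polynomial.coeff_X_pow]
    rw [Finset.sum_eq_single i]
    · simp
    · intro j _ hj
      simp [Fin.val_inj, Ne.symm hj]
    · simp
  have hz : f = 0 := by
    by_contra hne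
    have h1 := minpoly.degree_le_of_ne_zero ℚ (zt d) hne hf
    rw [← Polynomial.cyclotomic_eq_minpoly_rat (zt_prim (show d ≠ 0 by omega)) (by omega),
      Polynomial.degree_cyclotomic] at h1
    have h2 : f.degree < d.totient := by
      rw [Polynomial.degree_lt_iff_coeff_zero]
      intro m hm
      by_cases hmd : m < d
      · have := hco ⟨m, hmd⟩
        simp only at this
        rw [this, h ⟨m, hmd⟩ hm, sub_self]
      · simp only [f, Polynomial.finsetSum_coeff, Polynomial.coeff_C_mul, Polynomial.coeff_X_pow]
        apply Finset.sum_eq_zero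
        intro j _
        rw [if_neg (by have := j.2; omega), mul_zero]
    exact absurd h1 (not_le.2 h2)
  ext i
  have := hco i
  rw [hz, Polynomial.coeff_zero] at this
  have : (s i : ℚ) = t i := by linarith
  exact_mod_cast this

noncomputable def Pr (q : ℝ) (n : ℕ) (z : ℂ) : ℝ :=
  open Classical in ∑ c : Fin n → Bool, if Ev n z c then bernWeight q n c else 0

lemma Pr_eq (q : ℝ) {a d : ℕ} (hd : 1 < d) : Pr q (a * d) (zt d) =
    open Classical in ∑ s ∈ Fintype.piFinset (fun _ : Fin d => range (a + 1)), 
      if ∑ i : Fin d, (s i : ℂ) * zt d ^ (i : ℕ) = 0 then ∏ i, phi q (s i) a else 0 := by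
  unfold Pr
  simp only [Ev_iff hd]
  exact push q a d (fun s => ∑ i : Fin d, (s i : ℂ) * zt d ^ (i : ℕ) = 0)

lemma Pr_prime (q : ℝ) {a p : ℕ} (hp : p.Prime) : Pr q (a * p) (zt p) =
    ∑ k ∈ range (a + 1), phi q k a ^ p := by
  classical
  rw [Pr_eq q hp.one_lt, ← Finset.sum_filter]
  have hp0 := hp.pos
  symm
  refine Finset.sum_bij' (fun k _ => fun _ => k) (fun s _ => s ⟨0, hp0⟩) ?_ ?_ ?_ ?_ ?_
  · intro k hk
    simp only [Finset.mem_filter, Fintype.mem_piFinset]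
    exact ⟨fun _ => hk, by rw [← Finset.mul_sum, geom_zero hp.one_lt, mul_zero]⟩
  · intro s hs
    simp only [Finset.mem_filter, Fintype.mem_piFinset] at hs
    exact hs.1 _
  · intro k _; rfl
  · intro s hs
    simp only [Finset.mem_filter, Fintype.mem_piFinset] at hs
    have : s = fun _ => s ⟨p - 1, by omega⟩ := by
      apply uniq hp.one_lt _ _ hs.2
      · rw [← Finset.mul_sum, geom_zero hp.one_lt, mul_zero]
      · intro i hi
        rw [Nat.totient_prime hp] at hi
        congr 1
        ext
        have := i.2
        simp only; omega
    rw [this]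
  · intro k _; simp

lemma Pr_le {q : ℝ} (h0 : 0 < q) (h1 : q < 1) {a d : ℕ} (hd : 1 < d) :
    Pr q (a * d) (zt d) ≤ Mx q a ^ d.totient := by
  classical
  rw [Pr_eq q hd, ← Finset.sum_filter]
  set E := (Fintype.piFinset (fun _ : Fin d => range (a + 1))).filter
    (fun s => ∑ i : Fin d, (s i : ℂ) * zt d ^ (i : ℕ) = 0) with hE
  let I : Finset (Fin d) := Finset.univ.filter (fun i => (i : ℕ) < d.totient)
  have hI : I.card = d.totient := by
    have := Fin.card_filter_val_lt (n := d) (m := d.totient)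
    rw [this, min_eq_right (Nat.totient_le d)]
  let J := {i : Fin d // ¬ (i : ℕ) < d.totient}
  have hprod : ∀ s : Fin d → ℕ, ∏ i, phi q (s i) a ≤ Mx q a ^ d.totient * ∏ i : J, phi q (s i) a := by
    intro s
    rw [← Finset.prod_filter_mul_prod_filter_not Finset.univ (fun i : Fin d => (i : ℕ) < d.totient)]
    have e1 : ∏ i ∈ Finset.univ.filter (fun i : Fin d => ¬ (i : ℕ) < d.totient), phi q (s i) a =
        ∏ i : J, phi q (s i) a := by
      rw [Finset.prod_subtype (p := fun i : Fin d => ¬ (i : ℕ) < d.totient)]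
      simp
    rw [e1]
    refine mul_le_mul_of_nonneg_right ?_ (Finset.prod_nonneg fun i _ => phi_nonneg h0 h1 _ _)
    refine (Finset.prod_le_prod (fun i _ => phi_nonneg h0 h1 _ _)
      (fun i _ => phi_le_Mx h0 h1 (s i) a)).trans ?_
    rw [Finset.prod_const]
    exact (congrArg (fun k => Mx q a ^ k) hI).le
  calc ∑ s ∈ E, ∏ i, phi q (s i) a ≤ ∑ s ∈ E, Mx q a ^ d.totient * ∏ i : J, phi q (s i) a :=
        Finset.sum_le_sum fun s _ => hprod s
    _ = Mx q a ^ d.totient * ∑ s ∈ E, ∏ i : J, phi q (s i) a := by rw [Finset.mul_sum]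
    _ ≤ Mx q a ^ d.totient * 1 := by
        refine mul_le_mul_of_nonneg_left ?_ (pow_nonneg (Mx_pos h0 h1 a).le _)
        have inj : Set.InjOn (fun (s : Fin d → ℕ) (i : J) => s i) (E : Set (Fin d → ℕ)) := by
          intro s hs t ht hst
          simp only [hE, Finset.coe_filter, Set.mem_ofPred_eq] at hs ht
          refine uniq hd s t hs.2 ht.2 fun i hi => ?_
          exact congrFun hst ⟨i, not_lt.2 hi⟩
        have := Finset.sum_image (s := E) (f := fun t : J → ℕ => ∏ i : J, phi q (t i) a) inj
        rw [← this]
        have one : ∑ t ∈ Fintype.piFinset (fun _ : J => range (a + 1)), ∏ i : J, phi q (t i) a = 1 := by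
          rw [← Finset.prod_univ_sum (fun _ : J => range (a + 1)) (fun _ k => phi q k a)]
          simp [phi_sum]
        rw [← one]
        apply Finset.sum_le_sum_of_subset_of_nonneg
        · intro t ht
          rw [Finset.mem_image] at ht
          obtain ⟨s, hs, rfl⟩ := ht
          simp only [hE, Finset.mem_filter, Fintype.mem_piFinset] at hs
          rw [Fintype.mem_piFinset]
          exact fun i => hs.1 i
        · intro t _ _
          exact Finset.prod_nonneg fun i _ => phi_nonneg h0 h1 _ _
    _ = _ := mul_one _

lemma Pr_one {q : ℝ} (n : ℕ) : Pr q n (zt 1) = if Even n then phi q (n / 2) n else 0 := by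
  classical
  have hz : zt 1 = 1 := by simpa using (zt_prim (d := 1) one_ne_zero).pow_eq_one
  have h : ∀ c : Fin n → Bool, Ev n (zt 1) c ↔ 2 * cnt c = n := by
    intro c
    unfold Ev
    have h2 : ∀ l : Fin n, (if c l then (1:ℂ) else -1) * zt 1 ^ (l : ℕ) =
      2 * (if c l then (1:ℂ) else 0) - 1 := by
      intro l; rw [hz]; split_ifs <;> norm_num
    simp only [h2]
    rw [Finset.sum_sub_distrib, ← Finset.mul_sum, Finset.sum_boole]
    simp only [Finset.sum_const, Finset.card_univ, Fintype.card_fin, nsmul_eq_mul, mul_one, sub_eq_zero]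
    exact_mod_cast Iff.rfl
  unfold Pr
  simp only [h]
  split_ifs with he
  · rw [← sum_cnt]
    refine Finset.sum_congr rfl fun c _ => ?_
    have : 2 * cnt c = n ↔ cnt c = n / 2 := by obtain ⟨m, rfl⟩ := he; omega
    simp only [this]
  · apply Finset.sum_eq_zero
    intro c _
    rw [if_neg]
    intro hc
    exact he ⟨cnt c, by omega⟩

lemma PqPlus_ge {q : ℝ} (h0 : 0 < q) (h1 : q < 1) {n d : ℕ} (hn : n ≠ 0) (hd : d ∣ n) :
    Pr q n (zt d) ≤ PqPlus q n := by
  classical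
  unfold Pr PqPlus
  refine Finset.sum_le_sum fun c _ => ?_
  have := bern_nonneg h0 h1 n c
  by_cases h : Ev n (zt d) c
  · rw [if_pos h, if_pos ((det_iff' n hn c).2 ⟨d, Nat.mem_divisors.2 ⟨hd, hn⟩, h⟩)]
  · rw [if_neg h]; split_ifs <;> simp [this]

lemma PqPlus_le {q : ℝ} (h0 : 0 < q) (h1 : q < 1) {n : ℕ} (hn : n ≠ 0) :
    PqPlus q n ≤ ∑ d ∈ n.divisors, Pr q n (zt d) := by
  classical
  unfold Pr PqPlus
  rw [Finset.sum_comm]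
  refine Finset.sum_le_sum fun c _ => ?_
  have hb := bern_nonneg h0 h1 n c
  have hnn : ∀ d ∈ n.divisors, 0 ≤ (if Ev n (zt d) c then bernWeight q n c else 0) := by
    intro d _; split_ifs <;> simp [hb]
  split_ifs with h
  · obtain ⟨d, hd, he⟩ := (det_iff' n hn c).1 h
    have := Finset.single_le_sum hnn hd
    rwa [if_pos he] at this
  · exact Finset.sum_nonneg hnn
lemma prod_one_sub (P : Finset ℕ) (hP : ∀ p ∈ P, 2 ≤ p) :
    1 / ((P.card : ℝ) + 1) ≤ ∏ p ∈ P, (1 - (p : ℝ)⁻¹) := by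
  induction P using Finset.induction_on_max with
  | empty => simp
  | insert x s hx ih =>
    have hxs : x ∉ s := fun h => lt_irrefl _ (hx x h)
    rw [Finset.prod_insert hxs, Finset.card_insert_of_notMem hxs]
    have h1 := ih fun p hp => hP p (Finset.mem_insert_of_mem hp)
    have hcard : s.card + 2 ≤ x := by
      have h2 : s ⊆ Finset.Ico 2 x := fun p hp => by
        rw [Finset.mem_Ico]; exact ⟨hP p (Finset.mem_insert_of_mem hp), hx p hp⟩
      have := Finset.card_le_card h2
      have := hP x (Finset.mem_insert_self _ _)
      simp at *
      omega
    have hc : (s.card : ℝ) + 2 ≤ x := by exact_mod_cast hcard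
    have h3 : ((s.card : ℝ) + 1) / (s.card + 2) ≤ 1 - (x : ℝ)⁻¹ := by
      have : (x : ℝ)⁻¹ ≤ ((s.card : ℝ) + 2)⁻¹ := by gcongr
      have e : ((s.card : ℝ) + 1) / (s.card + 2) = 1 - ((s.card : ℝ) + 2)⁻¹ := by field_simp; ring
      linarith
    calc 1 / (((s.card + 1 : ℕ) : ℝ) + 1) = ((s.card : ℝ) + 1) / (s.card + 2) * (1 / ((s.card : ℝ) + 1)) := by
          push_cast; field_simp; ring
      _ ≤ _ := by
        apply mul_le_mul h3 h1 (by positivity)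
        refine le_trans (by positivity) h3

lemma totient_lower {d : ℕ} (hd : 0 < d) :
    (d : ℝ) ≤ d.totient * (1 + 2 * Real.log d) := by
  have h1 : (d.totient : ℝ) = d * ∏ p ∈ d.primeFactors, (1 - (p : ℝ)⁻¹) := by
    have := Nat.totient_eq_mul_prod_factors d
    have h2 := congrArg (fun x : ℚ => (x : ℝ)) this
    push_cast at h2
    exact h2
  have h2 := prod_one_sub d.primeFactors fun p hp => (Nat.prime_of_mem_primeFactors hp).two_le
  have h3 : 2 ^ d.primeFactors.card ≤ d := by
    calc 2 ^ d.primeFactors.card ≤ ∏ p ∈ d.primeFactors, p :=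
          Finset.pow_card_le_prod _ _ _ fun p hp => (Nat.prime_of_mem_primeFactors hp).two_le
      _ ≤ d := Nat.le_of_dvd hd (Nat.prod_primeFactors_dvd d)
  have h4 : (d.primeFactors.card : ℝ) * Real.log 2 ≤ Real.log d := by
    rw [← Real.log_pow]
    apply Real.log_le_log (by positivity)
    exact_mod_cast h3
  have h5 : (d.primeFactors.card : ℝ) ≤ 2 * Real.log d := by
    have := Real.log_two_gt_d9
    have : (0:ℝ) ≤ d.primeFactors.card := by positivity
    nlinarith
  have hd' : (0:ℝ) < d := by exact_mod_cast hd
  rw [div_le_iff₀ (by positivity)] at h2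
  have hp : 0 ≤ ∏ p ∈ d.primeFactors, (1 - (p : ℝ)⁻¹) := by
    by_contra hc
    push Not at hc
    have : (0:ℝ) ≤ d.primeFactors.card := by positivity
    nlinarith
  rw [h1, mul_assoc]
  nlinarith [mul_le_mul_of_nonneg_left h5 hp]

lemma big_d {α : ℝ} (ha0 : 0 < α) (ha1 : α < 1) (C : ℕ) :
    ∀ᶠ d : ℕ in Filter.atTop, ∀ p : ℕ, p * p ≤ d →
      p ≤ d.totient ∧ α ^ (d.totient - p) * (d : ℝ) ^ (C * p) * (d : ℝ) ^ 2 ≤ 1 := by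
  set L := - Real.log α with hL
  have hLp : 0 < L := by have := Real.log_neg ha0 ha1; linarith
  set K := 3 * (1 + (C + 2) / L) with hK
  have hKp : 0 < K := by positivity
  have hlo := (Real.isLittleO_pow_log_id_atTop (n := 2)).def (show 0 < 1 / (4 * K) by positivity)
  have hs : Filter.Tendsto (fun d : ℕ => Real.sqrt d) Filter.atTop Filter.atTop :=
    Real.tendsto_sqrt_atTop.comp tendsto_natCast_atTop_atTop
  filter_upwards [hs.eventually hlo, Filter.eventually_ge_atTop 3] with d hd h3 p hp
  have hd3 : (3:ℝ) ≤ d := by exact_mod_cast h3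
  have hd0 : (0:ℝ) < d := by linarith
  set x := Real.sqrt d with hx
  set l := Real.log d with hl
  have hxx : x * x = d := Real.mul_self_sqrt hd0.le
  have hx1 : 1 ≤ x := by rw [hx, Real.one_le_sqrt]; linarith
  have hl1 : 1 ≤ l := by
    rw [hl, Real.le_log_iff_exp_le hd0]
    have := Real.exp_one_lt_d9
    linarith
  have hlx : Real.log x = l / 2 := by rw [hx, Real.log_sqrt hd0.le]
  have hkl : K * l ^ 2 ≤ x := by
    simp only [id, hlx, Real.norm_eq_abs] at hd
    rw [abs_of_nonneg (by positivity), abs_of_nonneg (by positivity)] at hd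
    have : (l/2)^2 * (4 * K) ≤ x := by
      rw [div_mul_eq_mul_div, one_mul, le_div_iff₀ (by positivity)] at hd
      exact hd
    linarith
  have hpx : (p : ℝ) ≤ x := by
    rw [hx]; apply Real.le_sqrt_of_sq_le
    rw [sq]; exact_mod_cast hp
  have ht := totient_lower (show 0 < d by omega)
  rw [← hl] at ht
  set T := (d.totient : ℝ) with hT
  have hT0 : 0 ≤ T := by positivity
  -- T * 3 l ≥ x * x ≥ x * K * l^2
  have h1 : x * (1 + (C + 2) / L) * l ≤ T := by
    have e1 : x * (K * l ^ 2) ≤ T * (3 * l) := by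
      calc x * (K * l ^ 2) ≤ x * x := by gcongr
        _ = d := hxx
        _ ≤ _ := ht
        _ ≤ _ := by gcongr; linarith
    have e2 : (x * (1 + (C + 2) / L) * l) * (3 * l) ≤ T * (3 * l) := by
      calc _ = x * (K * l ^ 2) := by rw [hK]; ring
        _ ≤ _ := e1
    exact le_of_mul_le_mul_right e2 (by positivity)
  have h2 : (p : ℝ) + (C * p + 2) / L * l ≤ T := by
    have : (p : ℝ) + (C * p + 2) / L * l ≤ x * l + (C * x + 2 * x) / L * l := by
      have a1 : (p : ℝ) ≤ x * l := by nlinarith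
      have a2 : (C * (p:ℝ) + 2) / L * l ≤ (C * x + 2 * x) / L * l := by
        gcongr
        linarith
      linarith
    refine this.trans (le_of_eq_of_le ?_ h1)
    field_simp
  have hpT : p ≤ d.totient := by
    have : (p:ℝ) ≤ T := by
      have : 0 ≤ (C * (p:ℝ) + 2) / L * l := by positivity
      linarith
    rw [hT] at this
    exact_mod_cast this
  refine ⟨hpT, ?_⟩
  have hpos : 0 < α ^ (d.totient - p) * (d : ℝ) ^ (C * p) * (d : ℝ) ^ 2 := by positivity
  rw [← Real.log_nonpos_iff hpos.le, Real.log_mul (by positivity) (by positivity),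
    Real.log_mul (by positivity) (by positivity), Real.log_pow, Real.log_pow, Real.log_pow, ← hl,
    Nat.cast_sub hpT]
  push_cast
  have e : Real.log α = - L := by rw [hL]; ring
  rw [e, ← hT]
  have : (C * (p:ℝ) + 2) * l ≤ (T - p) * L := by
    have : (C * (p:ℝ) + 2) / L * l ≤ T - p := by linarith
    calc (C * (p:ℝ) + 2) * l = ((C * (p:ℝ) + 2) / L * l) * L := by field_simp
      _ ≤ _ := by gcongr
  linarith

/-- every nontrivial divisor other than the least prime factor has big totient -/
lemma totient_ge_of_lt {p d : ℕ} (hp : 2 ≤ p) (hpd : p < d) (hmin : p ≤ d.minFac) : p ≤ d.totient := by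
  rw [Nat.totient_eq_card_coprime]
  have hsub : insert (d - 1) (Finset.Ico 1 p) ⊆ (range d).filter d.Coprime := by
    intro x hx
    rw [Finset.mem_insert, Finset.mem_Ico] at hx
    rw [Finset.mem_filter, Finset.mem_range]
    rcases hx with rfl | hx
    · refine ⟨by omega, ?_⟩
      have : d = (d - 1) + 1 := by omega
      conv_lhs => rw [this]
      simp
    · refine ⟨by omega, ?_⟩
      by_contra hc
      obtain ⟨r, hr, h1, h2⟩ := Nat.Prime.not_coprime_iff_dvd.1 hc
      have := Nat.minFac_le_of_dvd hr.two_le h1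
      have := Nat.le_of_dvd (by omega) h2
      omega
  have := Finset.card_le_card hsub
  rw [Finset.card_insert_of_notMem (by simp; omega)] at this
  rw [Nat.card_Ico] at this
  exact le_trans (by omega) this
noncomputable def Sm (q : ℝ) (n : ℕ) : ℝ :=
  ∑ k ∈ Finset.range (n / n.minFac + 1), (phi q k (n / n.minFac)) ^ n.minFac

section
variable {q : ℝ} (h0 : 0 < q) (h1 : q < 1)
include h0 h1

lemma Sm_ge (n : ℕ) : Mx q (n / n.minFac) ^ n.minFac ≤ Sm q n := S_ge h0 h1 _ _

lemma Sm_pos (n : ℕ) : 0 < Sm q n :=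
  lt_of_lt_of_le (pow_pos (Mx_pos h0 h1 _) _) (Sm_ge h0 h1 n)

lemma Sm_eq {n : ℕ} (hn : 2 ≤ n) : Pr q n (zt n.minFac) = Sm q n := by
  have h := Pr_prime q (a := n / n.minFac) (Nat.minFac_prime (show n ≠ 1 by omega))
  rw [Nat.div_mul_cancel (Nat.minFac_dvd n)] at h
  exact h

lemma Pr_le' {n d : ℕ} (hdn : d ∣ n) (hd : 1 < d) :
    Pr q n (zt d) ≤ Mx q (n / d) ^ d.totient := by
  have h := Pr_le h0 h1 (a := n / d) hd
  rwa [Nat.div_mul_cancel hdn] at h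

/-- comparison of powers -/
lemma cmp_pow {C : ℕ} (hC : 1 / q ≤ C) {n d p : ℕ} (hn : 0 < n) (hdn : d ∣ n) (hpn : p ∣ n)
    (hpd : p ≤ d) (hp : 0 < p) :
    Mx q (n / d) ^ p ≤ Mx q (n / p) ^ p * ((d : ℝ) / p) ^ (C * p) := by
  have hd : 0 < d := by omega
  have ha : 0 < n / d := Nat.div_pos (Nat.le_of_dvd hn hdn) hd
  have h := Mx_grow h0 h1 hC ha (Nat.div_le_div_left hpd hp)
  have e : ((n / p : ℕ) : ℝ) / ((n / d : ℕ) : ℝ) = (d : ℝ) / p := by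
    have hp' : (p : ℝ) ≠ 0 := by positivity
    have hd' : (d : ℝ) ≠ 0 := by positivity
    have hn' : (n : ℝ) ≠ 0 := by positivity
    rw [Nat.cast_div hpn hp', Nat.cast_div hdn hd']
    field_simp
  rw [e] at h
  rw [pow_mul, ← mul_pow]
  exact pow_le_pow_left₀ (Mx_pos h0 h1 _).le h p

/-- divisors in the tail -/
lemma tail_bound : ∃ D0 : ℕ, ∀ n d : ℕ, 2 ≤ n → d ∣ n → d ≠ 1 → d ≠ n.minFac → D0 ≤ d →
    n.minFac * n.minFac ≤ d → Pr q n (zt d) ≤ Sm q n * ((d : ℝ) ^ 2)⁻¹ := by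
  obtain ⟨C, hC⟩ := exists_nat_ge (1 / q)
  obtain ⟨D0, hD⟩ := Filter.eventually_atTop.1 (big_d (Mx_pos h0 h1 1) (Mx_one_lt h0 h1) C)
  refine ⟨D0, fun n d hn hdn hd1 hdp hd0 hpp => ?_⟩
  set p := n.minFac with hp
  have hpp' : p.Prime := Nat.minFac_prime (by omega)
  have hdpos : 0 < d := Nat.pos_of_dvd_of_pos hdn (by omega)
  have hd2 : 1 < d := by omega
  have hpd : p ≤ d := Nat.minFac_le_of_dvd hd2 hdn
  obtain ⟨h3, h4⟩ := hD d hd0 p hpp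
  have hM0 := fun m => (Mx_pos h0 h1 m).le
  have ha : 1 ≤ n / d := Nat.div_pos (Nat.le_of_dvd (by omega) hdn) hdpos
  have hdR : (0:ℝ) < d := by exact_mod_cast hdpos
  have hp1 : (1:ℝ) ≤ p := by exact_mod_cast hpp'.one_lt.le
  calc Pr q n (zt d) ≤ Mx q (n / d) ^ d.totient := Pr_le' h0 h1 hdn hd2
    _ = Mx q (n / d) ^ (d.totient - p) * Mx q (n / d) ^ p := by rw [← pow_add, Nat.sub_add_cancel h3]
    _ ≤ Mx q 1 ^ (d.totient - p) * (Mx q (n / p) ^ p * ((d : ℝ) / p) ^ (C * p)) := by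
        apply mul_le_mul
        · exact pow_le_pow_left₀ (hM0 _) (Mx_anti h0 h1 ha) _
        · exact cmp_pow h0 h1 hC (by omega) hdn (Nat.minFac_dvd n) hpd hpp'.pos
        · exact pow_nonneg (hM0 _) _
        · exact pow_nonneg (hM0 _) _
    _ ≤ Mx q 1 ^ (d.totient - p) * (Sm q n * (d : ℝ) ^ (C * p)) := by
        have hS := Sm_ge h0 h1 n
        rw [← hp] at hS
        have := (Sm_pos h0 h1 n).le
        have := hM0 1
        have hdp' : (d:ℝ) / p ≤ d := div_le_self hdR.le hp1
        gcongr
    _ = Sm q n * (Mx q 1 ^ (d.totient - p) * (d : ℝ) ^ (C * p) * (d : ℝ) ^ 2) * ((d : ℝ) ^ 2)⁻¹ := by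
        field_simp
    _ ≤ Sm q n * 1 * ((d : ℝ) ^ 2)⁻¹ := by
        have := (Sm_pos h0 h1 n).le
        gcongr
    _ = _ := by rw [mul_one]

/-- primes between `p` and `p ^ 2` when `p` is large -/
lemma mid_bound : ∃ E : ℝ, 0 < E ∧ ∀ n d : ℕ, 2 ≤ n → 3 ≤ n.minFac → d ∣ n → d ≠ 1 → d ≠ n.minFac →
    d < n.minFac * n.minFac → n.minFac + 2 ≤ d ∧
      Pr q n (zt d) ≤ Sm q n * (Mx q n.minFac * E) ^ (d - n.minFac - 1) := by
  obtain ⟨C, hC⟩ := exists_nat_ge (1 / q)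
  refine ⟨Real.exp (2 * C), Real.exp_pos _, fun n d hn hp3 hdn hd1 hdp hlt => ?_⟩
  set p := n.minFac with hp
  have hpp' : p.Prime := Nat.minFac_prime (by omega)
  have hdpos : 0 < d := Nat.pos_of_dvd_of_pos hdn (by omega)
  have hd2 : 1 < d := by omega
  have hpd : p ≤ d := Nat.minFac_le_of_dvd hd2 hdn
  have hdprime : d.Prime := by
    by_contra hc
    have h2 := Nat.minFac_sq_le_self hdpos hc
    have h3 : p ≤ d.minFac := Nat.minFac_le_of_dvd (Nat.minFac_prime hd1).two_le
      ((Nat.minFac_dvd d).trans hdn)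
    have : p * p ≤ d.minFac ^ 2 := by rw [sq]; exact Nat.mul_le_mul h3 h3
    omega
  have hpd2 : p + 2 ≤ d := by
    have o1 := hpp'.odd_of_ne_two (by omega)
    have o2 := hdprime.odd_of_ne_two (by omega)
    obtain ⟨u, hu⟩ := o1
    obtain ⟨v, hv⟩ := o2
    omega
  refine ⟨hpd2, ?_⟩
  have ha : p ≤ n / d := by
    apply Nat.minFac_le_of_dvd _ (Nat.div_dvd_of_dvd hdn)
    obtain ⟨e, he⟩ := hdn
    have h2 : n / d = e := by rw [he, Nat.mul_div_cancel_left _ hdpos]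
    rw [h2]
    rcases e with _ | _ | e
    · omega
    · exfalso
      have h3 : n = d := by simpa using he
      rw [h3, hdprime.minFac_eq] at hp
      omega
    · omega
  obtain ⟨h, rfl⟩ : ∃ h, d = p + (h + 1) + 1 := ⟨d - p - 2, by omega⟩
  have hsub : p + (h + 1) + 1 - p - 1 = h + 1 := by omega
  rw [hsub]
  have hM0 := fun m => (Mx_pos h0 h1 m).le
  have hpR : (0:ℝ) < p := by exact_mod_cast hpp'.pos
  have hexp : (((p + (h + 1) + 1 : ℕ) : ℝ) / p) ^ (C * p) ≤ Real.exp (2 * C) ^ (h + 1) := by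
    have e1 : ((p + (h + 1) + 1 : ℕ) : ℝ) / p ≤ Real.exp ((h + 2) / p) := by
      have := Real.add_one_le_exp (((h : ℝ) + 2) / p)
      refine le_trans (le_of_eq ?_) this
      push_cast; field_simp; ring
    calc _ ≤ Real.exp ((h + 2) / p) ^ (C * p) := by gcongr
      _ = Real.exp (C * (h + 2)) := by
        rw [← Real.exp_nat_mul]; congr 1; push_cast; field_simp
      _ ≤ Real.exp ((h + 1 : ℕ) * (2 * C)) := by
        apply Real.exp_le_exp.2
        push_cast
        have : (0:ℝ) ≤ C * h := by positivity
        nlinarith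
      _ = _ := by rw [← Real.exp_nat_mul]
  set d := p + (h + 1) + 1 with hd
  calc Pr q n (zt d) ≤ Mx q (n / d) ^ d.totient := Pr_le' h0 h1 hdn hd2
    _ = Mx q (n / d) ^ (h + 1) * Mx q (n / d) ^ p := by
        rw [Nat.totient_prime hdprime, ← pow_add]; congr 1; omega
    _ ≤ Mx q p ^ (h + 1) * (Mx q (n / p) ^ p * ((d : ℝ) / p) ^ (C * p)) := by
        apply mul_le_mul
        · exact pow_le_pow_left₀ (hM0 _) (Mx_anti h0 h1 ha) _
        · exact cmp_pow h0 h1 hC (by omega) hdn (Nat.minFac_dvd n) hpd hpp'.pos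
        · exact pow_nonneg (hM0 _) _
        · exact pow_nonneg (hM0 _) _
    _ ≤ Mx q p ^ (h + 1) * (Sm q n * Real.exp (2 * C) ^ (h + 1)) := by
        have hS := Sm_ge h0 h1 n
        rw [← hp] at hS
        have := (Sm_pos h0 h1 n).le
        have := hM0 p
        gcongr
    _ = _ := by rw [mul_pow]; ring

/-- small divisors, small `p` -/
lemma small_bound (P0 D1 : ℕ) (ε : ℝ) (hε : 0 < ε) : ∀ᶠ n : ℕ in Filter.atTop,
    ∀ d : ℕ, n.minFac < P0 → d ∣ n → d ≠ 1 → d ≠ n.minFac → d < D1 →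
      Pr q n (zt d) ≤ ε * Sm q n := by
  obtain ⟨C, hC⟩ := exists_nat_ge (1 / q)
  set B : ℝ := (D1 : ℝ) ^ (C * P0) * 2 ^ P0 with hB
  obtain ⟨K, hK⟩ := exists_nat_gt (B / ε)
  obtain ⟨m0, hm0⟩ := Filter.eventually_atTop.1 (flat_sum h0 h1 K)
  filter_upwards [Filter.eventually_ge_atTop (m0 * P0 + 2)] with n hn d hpP hdn hd1 hdp hdD
  set p := n.minFac with hp
  have hn2 : 2 ≤ n := by omega
  have hpp' : p.Prime := Nat.minFac_prime (by omega)
  have hdpos : 0 < d := Nat.pos_of_dvd_of_pos hdn (by omega)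
  have hd2 : 1 < d := by omega
  have hpd : p ≤ d := Nat.minFac_le_of_dvd hd2 hdn
  have hmin : p ≤ d.minFac := Nat.minFac_le_of_dvd (Nat.minFac_prime hd1).two_le
      ((Nat.minFac_dvd d).trans hdn)
  have ht := totient_ge_of_lt hpp'.two_le (show p < d by omega) hmin
  have hb : m0 ≤ n / p := by
    rw [Nat.le_div_iff_mul_le hpp'.pos]
    exact le_trans (Nat.mul_le_mul_left _ hpP.le) (by omega)
  have hflat := hm0 (n / p) hb p hpp'.one_lt.le
  have hM0 := fun m => (Mx_pos h0 h1 m).le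
  have hdR : (0:ℝ) < d := by exact_mod_cast hdpos
  have hp1 : (1:ℝ) ≤ p := by exact_mod_cast hpp'.one_lt.le
  have hdD' : (d:ℝ) ≤ D1 := by exact_mod_cast hdD.le
  have hD1 : (1:ℝ) ≤ D1 := by exact_mod_cast (show 1 ≤ D1 by omega)
  have hflat' : K * Mx q (n / p) ^ p ≤ Sm q n * 2 ^ P0 := by
    rw [div_pow, mul_div_assoc', div_le_iff₀ (by positivity)] at hflat
    refine hflat.trans ?_
    have : (2:ℝ) ^ p ≤ 2 ^ P0 := pow_le_pow_right₀ (by norm_num) hpP.le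
    have := (Sm_pos h0 h1 n).le
    exact mul_le_mul_of_nonneg_left (by assumption) this
  have hKp : 0 < (K : ℝ) := lt_of_le_of_lt (by positivity) hK
  have main : Pr q n (zt d) ≤ Mx q (n / p) ^ p * (D1 : ℝ) ^ (C * P0) := by
    calc Pr q n (zt d) ≤ Mx q (n / d) ^ d.totient := Pr_le' h0 h1 hdn hd2
      _ ≤ Mx q (n / d) ^ p := pow_le_pow_of_le_one (hM0 _) (Mx_le_one h0 h1 _) ht
      _ ≤ Mx q (n / p) ^ p * ((d : ℝ) / p) ^ (C * p) :=
          cmp_pow h0 h1 hC (by omega) hdn (Nat.minFac_dvd n) hpd hpp'.pos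
      _ ≤ Mx q (n / p) ^ p * (D1 : ℝ) ^ (C * P0) := by
        have := pow_nonneg (hM0 (n / p)) p
        gcongr
        calc ((d : ℝ) / p) ^ (C * p) ≤ (D1 : ℝ) ^ (C * p) := by
              gcongr
              exact (div_le_self hdR.le hp1).trans hdD'
          _ ≤ _ := pow_le_pow_right₀ hD1 (Nat.mul_le_mul_left _ hpP.le)
  have h5 : K * Pr q n (zt d) ≤ K * (ε * Sm q n) := by
    calc K * Pr q n (zt d) ≤ K * (Mx q (n / p) ^ p * (D1 : ℝ) ^ (C * P0)) := by gcongr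
      _ = (K * Mx q (n / p) ^ p) * (D1 : ℝ) ^ (C * P0) := by ring
      _ ≤ (Sm q n * 2 ^ P0) * (D1 : ℝ) ^ (C * P0) := by gcongr
      _ = B * Sm q n := by rw [hB]; ring
      _ ≤ (K * ε) * Sm q n := by
        have := (Sm_pos h0 h1 n).le
        rw [div_lt_iff₀ hε] at hK
        gcongr
      _ = _ := by ring
  exact le_of_mul_le_mul_left h5 hKp

lemma one_bound (hq : q ≠ 1 / 2) (ε : ℝ) (hε : 0 < ε) : ∀ᶠ n : ℕ in Filter.atTop,
    Pr q n (zt 1) ≤ ε * Sm q n := by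
  set β := 4 * (q * (1 - q)) with hβ
  have hq' : 0 < 1 - q := by linarith
  have hb0 : 0 < β := by positivity
  have hb1 : β < 1 := by
    have : 0 < (q - 1/2) ^ 2 := by
      have : q - 1/2 ≠ 0 := sub_ne_zero.2 hq
      positivity
    rw [hβ]; nlinarith
  have ht := tendsto_pow_const_mul_const_pow_of_lt_one 2 hb0.le hb1
  obtain ⟨m0, hm0⟩ := Filter.eventually_atTop.1
    (ht.eventually_le_const (show (0:ℝ) < ε / 4 by positivity))
  filter_upwards [Filter.eventually_ge_atTop (2 * m0 + 2)] with n hn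
  rw [Pr_one]
  have hS := Sm_pos h0 h1 n
  split_ifs with he
  · obtain ⟨m, rfl⟩ := he
    have hm1 : 1 ≤ m := by omega
    have hmf : (m + m).minFac = 2 := by
      rw [Nat.minFac_eq_two_iff]; omega
    have hge := Sm_ge h0 h1 (m + m)
    have hdiv : (m + m) / 2 = m := by omega
    rw [hmf, hdiv] at hge
    rw [hdiv]
    have hMg := Mx_ge h0 h1 m
    have hm1' : (1:ℝ) ≤ m := by exact_mod_cast hm1
    have hle : phi q m (m + m) ≤ β ^ m := by
      unfold phi
      have h4 : ((m + m).choose m : ℝ) ≤ 4 ^ m := by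
        have := Nat.choose_le_two_pow (m + m) m
        have e : (2:ℕ) ^ (m + m) = 4 ^ m := by rw [← two_mul, pow_mul]; norm_num
        rw [e] at this
        exact_mod_cast this
      rw [Nat.add_sub_cancel]
      calc _ ≤ (4:ℝ) ^ m * q ^ m * (1 - q) ^ m := by gcongr
        _ = _ := by rw [hβ, mul_pow, mul_pow]; ring
    have h6 := hm0 m (by omega)
    have h7 : β ^ m ≤ ε * (1 / ((m : ℝ) + 1)) ^ 2 := by
      rw [div_pow, one_pow, mul_one_div, le_div_iff₀ (by positivity)]
      have : ((m:ℝ) + 1) ^ 2 ≤ 4 * (m:ℝ) ^ 2 := by nlinarith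
      have hbm : 0 < β ^ m := by positivity
      nlinarith [mul_le_mul_of_nonneg_left this hbm.le]
    calc _ ≤ β ^ m := hle
      _ ≤ _ := h7
      _ ≤ ε * Mx q m ^ 2 := by gcongr
      _ ≤ _ := by gcongr
  · positivity

lemma rest_bound (ε : ℝ) (hε : 0 < ε) : ∀ᶠ n : ℕ in Filter.atTop,
    ∑ d ∈ (n.divisors.erase 1).erase n.minFac, Pr q n (zt d) ≤ ε * Sm q n := by
  obtain ⟨D0, hD0⟩ := tail_bound h0 h1
  obtain ⟨E, hE, hmid⟩ := mid_bound h0 h1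
  obtain ⟨P1, hP1⟩ := Filter.eventually_atTop.1
    ((Mx_tendsto h0 h1).eventually_le_const
      (show (0:ℝ) < min (1/2) (ε / 4) / E by positivity))
  obtain ⟨P2, hP2⟩ := exists_nat_gt (4 / ε)
  set P0 := D0 + P1 + P2 + 3 with hP0
  have hsq : P0 ≤ P0 * P0 := Nat.le_mul_self P0
  filter_upwards [Filter.eventually_ge_atTop 2,
    small_bound h0 h1 P0 (P0 * P0) (ε / 2 / (P0 * P0 : ℕ)) (by positivity)] with n hn hsmall
  set p := n.minFac with hp
  have hS := Sm_pos h0 h1 n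
  set X := (n.divisors.erase 1).erase p with hX
  have hmem : ∀ d ∈ X, d ∣ n ∧ d ≠ 1 ∧ d ≠ p := by
    intro d hd
    simp only [hX, Finset.mem_erase, Nat.mem_divisors] at hd
    exact ⟨hd.2.2.1, hd.2.1, hd.1⟩
  set B := max (P0 * P0) (p * p) with hB
  rw [← Finset.sum_filter_add_sum_filter_not X (fun d => B ≤ d)]
  have part1 : ∑ d ∈ X.filter (fun d => B ≤ d), Pr q n (zt d) ≤ ε / 2 * Sm q n := by
    calc _ ≤ ∑ d ∈ X.filter (fun d => B ≤ d), Sm q n * ((d : ℝ) ^ 2)⁻¹ := by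
          refine Finset.sum_le_sum fun d hd => ?_
          rw [Finset.mem_filter] at hd
          obtain ⟨a1, a2, a3⟩ := hmem d hd.1
          have b1 : P0 * P0 ≤ d := (le_max_left _ _).trans hd.2
          exact hD0 n d hn a1 a2 a3 (by omega) ((le_max_right _ _).trans hd.2)
      _ = Sm q n * ∑ d ∈ X.filter (fun d => B ≤ d), ((d : ℝ) ^ 2)⁻¹ := by rw [Finset.mul_sum]
      _ ≤ Sm q n * ∑ d ∈ Finset.Ioo (P0 * P0 - 1) (n + 1), ((d : ℝ) ^ 2)⁻¹ := by
          refine mul_le_mul_of_nonneg_left ?_ hS.le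
          apply Finset.sum_le_sum_of_subset_of_nonneg
          · intro d hd
            rw [Finset.mem_filter] at hd
            obtain ⟨a1, a2, a3⟩ := hmem d hd.1
            have b1 : P0 * P0 ≤ d := (le_max_left _ _).trans hd.2
            have := Nat.le_of_dvd (by omega) a1
            rw [Finset.mem_Ioo]; omega
          · intros; positivity
      _ ≤ Sm q n * (2 / ((P0 * P0 - 1 : ℕ) + 1)) := by
          refine mul_le_mul_of_nonneg_left ?_ hS.le
          exact sum_Ioo_inv_sq_le _ _
      _ ≤ Sm q n * (ε / 2) := by
          refine mul_le_mul_of_nonneg_left ?_ hS.le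
          have : (P2 : ℝ) ≤ ((P0 * P0 - 1 : ℕ) : ℝ) := by exact_mod_cast (by omega)
          rw [div_lt_iff₀ hε] at hP2
          rw [div_le_iff₀ (by positivity)]
          nlinarith
      _ = _ := by ring
  have part2 : ∑ d ∈ X.filter (fun d => ¬ B ≤ d), Pr q n (zt d) ≤ ε / 2 * Sm q n := by
    rcases lt_or_ge p P0 with hlt | hge
    · have hBe : B = P0 * P0 := max_eq_left (Nat.mul_le_mul hlt.le hlt.le)
      calc _ ≤ ∑ d ∈ X.filter (fun d => ¬ B ≤ d), ε / 2 / (P0 * P0 : ℕ) * Sm q n := by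
            refine Finset.sum_le_sum fun d hd => ?_
            rw [Finset.mem_filter] at hd
            obtain ⟨a1, a2, a3⟩ := hmem d hd.1
            exact hsmall d hlt a1 a2 a3 (by rw [← hBe]; omega)
        _ ≤ ∑ d ∈ range (P0 * P0), ε / 2 / (P0 * P0 : ℕ) * Sm q n := by
            apply Finset.sum_le_sum_of_subset_of_nonneg
            · intro d hd
              rw [Finset.mem_filter, hBe] at hd
              rw [Finset.mem_range]; omega
            · intros; positivity
        _ = _ := by
            rw [Finset.sum_const, Finset.card_range, nsmul_eq_mul]
            have : ((P0 * P0 : ℕ) : ℝ) ≠ 0 := by positivity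
            field_simp
    · have hBe : B = p * p := max_eq_right (Nat.mul_le_mul hge hge)
      set r := Mx q p * E with hr
      have hr0 : 0 < r := mul_pos (Mx_pos h0 h1 p) hE
      have hrl : r ≤ min (1/2) (ε / 4) := by
        have := hP1 p (by omega)
        rwa [le_div_iff₀ hE] at this
      have hr1 : r ≤ 1/2 := hrl.trans (min_le_left _ _)
      have hr2 : r ≤ ε / 4 := hrl.trans (min_le_right _ _)
      have hm : ∀ d ∈ X.filter (fun d => ¬ B ≤ d), p + 2 ≤ d ∧
          Pr q n (zt d) ≤ Sm q n * r ^ (d - p - 1) := by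
        intro d hd
        rw [Finset.mem_filter, hBe] at hd
        obtain ⟨a1, a2, a3⟩ := hmem d hd.1
        exact hmid n d hn (by omega) a1 a2 a3 (not_le.1 hd.2)
      calc _ ≤ ∑ d ∈ X.filter (fun d => ¬ B ≤ d), Sm q n * r ^ (d - p - 1) :=
            Finset.sum_le_sum fun d hd => (hm d hd).2
        _ = Sm q n * ∑ d ∈ X.filter (fun d => ¬ B ≤ d), r ^ (d - p - 1) := by rw [Finset.mul_sum]
        _ ≤ Sm q n * ∑ i ∈ Finset.Ico 1 (p * p), r ^ i := by
            refine mul_le_mul_of_nonneg_left ?_ hS.le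
            rw [← Finset.sum_image (s := X.filter (fun d => ¬ B ≤ d)) (g := fun d => d - p - 1)
              (f := fun i => r ^ i)]
            · apply Finset.sum_le_sum_of_subset_of_nonneg
              · intro i hi
                rw [Finset.mem_image] at hi
                obtain ⟨d, hd, rfl⟩ := hi
                have := (hm d hd).1
                rw [Finset.mem_filter, hBe] at hd
                rw [Finset.mem_Ico]; omega
              · intros; positivity
            · intro d hd d' hd' h
              have := (hm d hd).1
              have := (hm d' hd').1
              simp only at h
              omega
        _ ≤ Sm q n * (r ^ 1 / (1 - r)) := by
            refine mul_le_mul_of_nonneg_left ?_ hS.le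
            exact geom_sum_Ico_le_of_lt_one hr0.le (by linarith)
        _ ≤ Sm q n * (ε / 2) := by
            refine mul_le_mul_of_nonneg_left ?_ hS.le
            rw [div_le_iff₀ (by linarith), pow_one]
            nlinarith
        _ = _ := by ring
  linarith

end

/-- Corollary (signed case, q ≠ 1/2): for fixed q ∈ (0,1) with q ≠ 1/2,
P_q^+(n) ∼ ∑_{k=0}^{n/p(n)} φ_q(k, n/p(n))^{p(n)} as n → ∞. -/
theorem PqPlus_asymptotic (q : ℝ) (hq0 : 0 < q) (hq1 : q < 1) (hq : q ≠ 1 / 2) :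
    Filter.Tendsto
      (fun n : ℕ =>
        PqPlus q n /
          ∑ k ∈ Finset.range (n / n.minFac + 1), (phi q k (n / n.minFac)) ^ n.minFac)
      Filter.atTop (nhds 1) := by
  change Filter.Tendsto (fun n : ℕ => PqPlus q n / Sm q n) Filter.atTop (nhds 1)
  rw [Metric.tendsto_nhds]
  intro ε hε
  filter_upwards [Filter.eventually_ge_atTop 2, one_bound hq0 hq1 hq (ε / 3) (by positivity),
    rest_bound hq0 hq1 (ε / 3) (by positivity)] with n hn h1 h2
  have hS := Sm_pos hq0 hq1 n
  have hlow : Sm q n ≤ PqPlus q n := by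
    rw [← Sm_eq hq0 hq1 hn]
    exact PqPlus_ge hq0 hq1 (by omega) (Nat.minFac_dvd n)
  have hup : PqPlus q n ≤ Sm q n + 2 * (ε / 3) * Sm q n := by
    have h3 := PqPlus_le hq0 hq1 (show n ≠ 0 by omega)
    have m1 : 1 ∈ n.divisors := Nat.one_mem_divisors.2 (by omega)
    have m2 : n.minFac ∈ n.divisors.erase 1 := by
      rw [Finset.mem_erase, Nat.mem_divisors]
      exact ⟨(Nat.minFac_prime (by omega)).ne_one, Nat.minFac_dvd n, by omega⟩
    rw [← Finset.add_sum_erase _ _ m1, ← Finset.add_sum_erase _ _ m2, Sm_eq hq0 hq1 hn] at h3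
    linarith
  rw [Real.dist_eq, abs_of_nonneg (by rw [sub_nonneg, le_div_iff₀ hS]; linarith), sub_lt_iff_lt_add,
    div_lt_iff₀ hS]
  nlinarith
end

section
/- For q = 1/2, P_{1/2}^+(n) ∼ 2√2/√(πn) as n → ∞ over even integers n; i.e., P_{1/2}^+(n)·√(πn)/(2√2) tends to 1 as n → ∞ through even n. -/
open Finset

theorem gen_count {ι α V : Type*} [Fintype ι] [DecidableEq ι] [Fintype α] [DecidableEq α]
    [AddCommGroup V] [Module ℚ V] [DecidableEq V] (S : α → ℤ) (K : ℕ)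
    (hK : ∀ v, (univ.filter (fun a => S a = v)).card ≤ K) (w : ι → V) (p : ι → Prop)
    [DecidablePred p] (hw : LinearIndependent ℚ (fun i : {i // p i} => w i)) :
    (univ.filter (fun x : ι → α => ∑ i, (S (x i) : ℚ) • w i = 0)).card ≤
      K ^ Fintype.card {i // p i} * Fintype.card α ^ Fintype.card {i // ¬ p i} := by
  classical
  have h1 : (univ.filter (fun x : ι → α => ∑ i, (S (x i) : ℚ) • w i = 0)).card =
     (univ.filter (fun z : ({i // p i} → α) × ({i // ¬ p i} → α) => 
        ∑ i : {i // p i}, (S (z.1 i) : ℚ) • w i + ∑ i : {i // ¬ p i}, (S (z.2 i) : ℚ) • w i = 0)).card := by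
    apply Finset.card_equiv (Equiv.piEquivPiSubtypeProd p (fun _ => α))
    intro x
    simp only [mem_filter, mem_univ, true_and]
    rw [← Fintype.sum_subtype_add_sum_subtype p (fun i => (S (x i) : ℚ) • w i)]
    rfl
  rw [h1]
  have h2 : Fintype.card α ^ Fintype.card {i // ¬ p i} = 
     (univ : Finset ({i // ¬ p i} → α)).card := by simp
  rw [h2]
  refine Finset.card_le_mul_card_image_of_maps_to (f := Prod.snd) (fun _ _ => mem_univ _) _ ?_
  intro y _
  rcases Finset.eq_empty_or_nonempty ((univ.filter (fun z : ({i // p i} → α) × ({i // ¬ p i} → α) => 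
        ∑ i : {i // p i}, (S (z.1 i) : ℚ) • w i + ∑ i : {i // ¬ p i}, (S (z.2 i) : ℚ) • w i = 0)).filter (fun z => z.2 = y)) with h | ⟨z0, hz0⟩
  · rw [h]; simp
  · simp only [mem_filter, mem_univ, true_and] at hz0
    calc _ ≤ (Fintype.piFinset (fun i : {i // p i} => univ.filter (fun a => S a = S (z0.1 i)))).card := by
          apply Finset.card_le_card_of_injOn Prod.fst
          · intro z hz
            simp only [coe_filter, mem_filter, mem_univ, true_and, Set.mem_ofPred_eq] at hz
            simp only [mem_coe, Fintype.mem_piFinset, mem_filter, mem_univ, true_and]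
            intro i
            have e : ∑ i : {i // p i}, ((S (z.1 i) : ℚ) - S (z0.1 i)) • w i = 0 := by
              simp only [sub_smul, Finset.sum_sub_distrib]
              have a1 := hz.1
              have a2 := hz0.1
              rw [hz.2] at a1
              rw [hz0.2] at a2
              rw [eq_neg_of_add_eq_zero_left a1, eq_neg_of_add_eq_zero_left a2, sub_self]
            have := Fintype.linearIndependent_iff.1 hw _ e i
            have := sub_eq_zero.1 this
            exact_mod_cast this
          · intro z hz z' hz' h
            simp only [coe_filter, mem_filter, mem_univ, true_and, Set.mem_ofPred_eq] at hz hz'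
            exact Prod.ext h (hz.2.trans hz'.2.symm)
      _ = ∏ i : {i // p i}, (univ.filter (fun a => S a = S (z0.1 i))).card := Fintype.card_piFinset _
      _ ≤ ∏ i : {i // p i}, K := Finset.prod_le_prod' (fun i _ => hK _)
      _ = _ := by simp

def sg (b : Bool) : ℤ := if b then 1 else -1

theorem sum_sg {m : ℕ} (c : Fin m → Bool) :
    ∑ j, sg (c j) = 2 * ((univ.filter (fun j => c j = true)).card : ℤ) - m := by
  have : ∀ j, sg (c j) = 2 * (if c j = true then 1 else 0) - 1 := by
    intro j; unfold sg; split_ifs <;> rfl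
  simp only [this, Finset.sum_sub_distrib, ← Finset.mul_sum, Finset.sum_boole]
  simp

theorem card_true {m : ℕ} (k : ℕ) :
    (univ.filter (fun c : Fin m → Bool => (univ.filter (fun j => c j = true)).card = k)).card = m.choose k := by
  rw [show m.choose k = ((univ : Finset (Fin m)).powersetCard k).card by simp]
  apply Finset.card_bij (fun c _ => univ.filter (fun j => c j = true))
  · intro c hc; simpa [mem_powersetCard] using hc
  · intro a _ b _ h
    funext j
    have := congrArg (fun s => j ∈ s) h
    simp at this
    exact this
  · intro s hs
    refine ⟨fun j => decide (j ∈ s), ?_, ?_⟩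
    · simpa [mem_powersetCard] using hs
    · ext; simp

theorem fiber_le {m : ℕ} (v : ℤ) :
    (univ.filter (fun c : Fin m → Bool => ∑ j, sg (c j) = v)).card ≤ m.choose (m / 2) := by
  rcases Finset.eq_empty_or_nonempty (univ.filter (fun c : Fin m → Bool => ∑ j, sg (c j) = v)) with h | ⟨c0, h0⟩
  · rw [h]; simp
  · simp only [mem_filter, mem_univ, true_and] at h0
    refine le_trans ?_ ((card_true (m := m) (univ.filter (fun j => c0 j = true)).card).le.trans (Nat.choose_le_middle _ _))
    apply Finset.card_le_card
    intro c hc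
    simp only [mem_filter, mem_univ, true_and] at hc ⊢
    rw [sum_sg] at hc h0
    omega

theorem card_zero {m : ℕ} :
    (univ.filter (fun c : Fin (2 * m) → Bool => ∑ j, sg (c j) = 0)).card = m.centralBinom := by
  rw [Nat.centralBinom, ← card_true]
  congr 1
  ext c
  simp only [mem_filter, mem_univ, true_and, sum_sg]
  push_cast
  omega

theorem card_zero_alt {m : ℕ} :
    (univ.filter (fun c : Fin (2 * m) → Bool => ∑ j, sg (c j) * (-1) ^ (j : ℕ) = 0)).card = m.centralBinom := by
  rw [← card_zero]
  have inv : Function.Involutive (fun (c : Fin (2 * m) → Bool) j => (c j ^^ decide (Odd (j : ℕ)))) := by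
    intro c; funext j; simp
  apply Finset.card_equiv (inv.toPerm)
  intro c
  simp only [mem_filter, mem_univ, true_and]
  have : ∀ j : Fin (2 * m), sg (c j) * (-1) ^ (j : ℕ) = sg (c j ^^ decide (Odd (j : ℕ))) := by
    intro j
    rcases Nat.even_or_odd (j : ℕ) with h | h
    · have : ¬ Odd (j : ℕ) := by simpa using h
      simp [h.neg_one_pow, this]
    · rw [h.neg_one_pow]; cases c j <;> simp [sg, h]
  simp [this]

theorem count_gen {d m : ℕ} {V : Type*} [AddCommGroup V] [Module ℚ V] [DecidableEq V]
    (w : ℕ → V) (hper : ∀ a b, w (b + d * a) = w b) (k : ℕ) (hk : k ≤ d)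
    (hw : LinearIndependent ℚ (fun i : Fin k => w i)) :
    (univ.filter (fun c : Fin (m * d) → Bool => ∑ j, (sg (c j) : ℚ) • w j = 0)).card ≤
      (m.choose (m / 2)) ^ k * (2 ^ m) ^ (d - k) := by
  have key := gen_count (ι := Fin d) (α := Fin m → Bool) (fun c => ∑ j, sg (c j)) (m.choose (m / 2))
    fiber_le (fun i => w i) (fun i => (i : ℕ) < k) (by
      let e : {i : Fin d // (i : ℕ) < k} → Fin k := fun i => ⟨i.1, i.2⟩
      have he : Function.Injective e := by
        intro a b h
        have := congrArg Fin.val h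
        exact Subtype.ext (Fin.ext this)
      exact hw.comp e he)
  have c1 : Fintype.card {i : Fin d // (i : ℕ) < k} = k := by
    rw [Fintype.card_subtype]
    rw [Fin.card_filter_val_lt, min_eq_right hk]
  have c2 : Fintype.card {i : Fin d // ¬ (i : ℕ) < k} = d - k := by
    rw [Fintype.card_subtype_compl, c1]; simp
  rw [c1, c2] at key
  simp only [Fintype.card_fun, Fintype.card_fin, Fintype.card_bool] at key
  refine le_trans (le_of_eq ?_) key
  let E : (Fin (m * d) → Bool) ≃ (Fin d → Fin m → Bool) :=
    { toFun := fun c b a => c (finProdFinEquiv (a, b))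
      invFun := fun x j => x (finProdFinEquiv.symm j).2 (finProdFinEquiv.symm j).1
      left_inv := by intro c; funext j; exact congrArg c (finProdFinEquiv.apply_symm_apply j)
      right_inv := by intro c; funext a b; simp }
  apply Finset.card_equiv E
  intro c
  simp only [mem_filter, mem_univ, true_and]
  rw [← finProdFinEquiv.sum_comp, Fintype.sum_prod_type_right]
  have : ∀ b : Fin d, ∑ a : Fin m, (sg (c (finProdFinEquiv (a, b))) : ℚ) • w (finProdFinEquiv (a, b) : Fin (m*d)) 
     = ((∑ a, sg (E c b a) : ℤ) : ℚ) • w b := by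
    intro b
    push_cast
    rw [Finset.sum_smul]
    apply Finset.sum_congr rfl
    intro a _
    rw [finProdFinEquiv_apply_val, hper]
    rfl
  simp only [this]

theorem count_root {d m : ℕ} (hd : 0 < d) (ω : ℂ) (hω : IsPrimitiveRoot ω d) :
    (univ.filter (fun c : Fin (m * d) → Bool => ∑ j, (sg (c j) : ℂ) * ω ^ (j : ℕ) = 0)).card ≤
      (m.choose (m / 2)) ^ d.totient * (2 ^ m) ^ (d - d.totient) := by
  have hli := linearIndependent_pow (K := ℚ) ω
  rw [← Polynomial.cyclotomic_eq_minpoly_rat hω hd, Polynomial.natDegree_cyclotomic] at hli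
  have := count_gen (d := d) (m := m) (fun j => ω ^ j) (by
    intro a b; rw [pow_add, pow_mul, hω.pow_eq_one]; simp) d.totient (Nat.totient_le d) hli
  refine le_trans (le_of_eq ?_) this
  refine congrArg Finset.card (Finset.filter_congr ?_)
  intro c _
  simp [Algebra.smul_def]

theorem count_both {m : ℕ} :
    (univ.filter (fun c : Fin (m * 2) → Bool => ∑ j, sg (c j) = 0 ∧ ∑ j, sg (c j) * (-1) ^ (j : ℕ) = 0)).card ≤
      (m.choose (m / 2)) ^ 2 := by
  have := count_gen (d := 2) (m := m) (fun j => ((1 : ℚ), (-1 : ℚ) ^ j)) (by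
    intro a b; simp [pow_add, pow_mul]) 2 le_rfl (by
      rw [Fintype.linearIndependent_iff]
      intro g h
      simp [Fin.sum_univ_two] at h
      intro i
      fin_cases i <;> simp <;> linarith [h.1, h.2])
  simp only [Nat.sub_self, pow_zero, mul_one] at this
  refine le_trans (le_of_eq ?_) this
  congr 1
  ext c
  simp only [mem_filter, mem_univ, true_and, Prod.ext_iff, Prod.fst_sum, Prod.snd_sum, Prod.smul_fst, Prod.smul_snd, smul_eq_mul, mul_one, Prod.fst_zero, Prod.snd_zero]
  norm_cast

theorem pow_fin {R : Type*} [Monoid R] {n : ℕ} [NeZero n] (ω : R) (h : ω ^ n = 1) (i j : Fin n) :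
    ω ^ ((j - i : Fin n) : ℕ) * ω ^ (i : ℕ) = ω ^ (j : ℕ) := by
  rw [← pow_add]
  conv_rhs => rw [show j = (j - i) + i by simp]
  rw [Fin.val_add, ← pow_eq_pow_mod _ h]

theorem sg_cast (b : Bool) : (if b = true then (1 : ℚ) else -1) = (sg b : ℚ) := by
  cases b <;> simp [sg]

theorem det_zero_of {n : ℕ} [NeZero n] (c : Fin n → Bool) (ω : ℚ) (h : ω ^ n = 1)
    (hs : ∑ j, (sg (c j) : ℚ) * ω ^ (j : ℕ) = 0) :
    (Matrix.of fun i j : Fin n => (if c (j - i) then (1 : ℚ) else -1)).det = 0 := by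
  rw [← Matrix.exists_mulVec_eq_zero_iff]
  refine ⟨fun j => ω ^ (j : ℕ), ?_, ?_⟩
  · intro h0
    have := congrFun h0 0
    simp at this
  · funext i
    simp only [Matrix.mulVec, dotProduct, Matrix.of_apply, sg_cast, Pi.zero_apply]
    calc _ = ∑ j, ((sg (c (j - i)) : ℚ) * ω ^ ((j - i : Fin n) : ℕ)) * ω ^ (i : ℕ) := by
          apply Finset.sum_congr rfl; intro j _; rw [mul_assoc, pow_fin ω h]
      _ = (∑ j, ((sg (c (j - i)) : ℚ) * ω ^ ((j - i : Fin n) : ℕ))) * ω ^ (i : ℕ) := by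
          rw [Finset.sum_mul]
      _ = 0 := by
          have := (Equiv.subRight i).sum_comp (fun j => (sg (c j) : ℚ) * ω ^ (j : ℕ))
          simp only [Equiv.subRight_apply] at this
          rw [this, hs, zero_mul]

theorem exists_root {n : ℕ} [NeZero n] (c : Fin n → Bool)
    (hdet : (Matrix.of fun i j : Fin n => (if c (j - i) then (1 : ℚ) else -1)).det = 0) :
    ∃ ω : ℂ, ω ^ n = 1 ∧ ∑ j, (sg (c j) : ℂ) * ω ^ (j : ℕ) = 0 := by
  rw [← Matrix.exists_mulVec_eq_zero_iff] at hdet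
  obtain ⟨v, hv, hM⟩ := hdet
  have hM' : ∀ i, ∑ j, (sg (c (j - i)) : ℂ) * (v j : ℂ) = 0 := by
    intro i
    have := congrFun hM i
    simp only [Matrix.mulVec, dotProduct, Matrix.of_apply, sg_cast, Pi.zero_apply] at this
    exact_mod_cast congrArg (fun x : ℚ => (x : ℂ)) this
  have hη : ∃ η : ℂ, η ^ n = 1 ∧ ∑ j : Fin n, (v j : ℂ) * η ^ (j : ℕ) ≠ 0 := by
    by_contra! hcon
    apply hv
    let P : Polynomial ℂ := ∑ j : Fin n, Polynomial.C (v j : ℂ) * Polynomial.X ^ (j : ℕ)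
    have hP : P = 0 := by
      apply Polynomial.eq_zero_of_degree_lt_of_eval_finset_eq_zero (Polynomial.nthRootsFinset n (1 : ℂ))
      · rw [(Complex.isPrimitiveRoot_exp n (NeZero.ne n)).card_nthRootsFinset]
        refine lt_of_le_of_lt (Polynomial.degree_sum_le _ _) ?_
        rw [Finset.sup_lt_iff (by exact WithBot.bot_lt_coe n)]
        intro j _
        refine lt_of_le_of_lt (Polynomial.degree_C_mul_X_pow_le _ _) ?_
        exact_mod_cast j.2
      · intro x hx
        rw [Polynomial.mem_nthRootsFinset (Nat.pos_of_ne_zero (NeZero.ne n))] at hx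
        simpa [P, Polynomial.eval_finsetSum] using hcon x hx
    funext k
    have := congrArg (fun Q => Polynomial.coeff Q (k : ℕ)) hP
    simp only [P, Polynomial.finsetSum_coeff, Polynomial.coeff_C_mul, Polynomial.coeff_X_pow, Polynomial.coeff_zero] at this
    simpa [Fin.val_inj] using this
  obtain ⟨η, h1, h2⟩ := hη
  have h3 : η⁻¹ ^ n = 1 := by simp [h1]
  have h0 : η ≠ 0 := by
    rintro rfl
    simp [NeZero.ne n] at h1
  refine ⟨η⁻¹, h3, ?_⟩
  have key : ∑ i : Fin n, η ^ (i : ℕ) * ∑ j, (sg (c (j - i)) : ℂ) * (v j : ℂ) = 0 := by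
    simp [hM']
  have e : ∑ i : Fin n, η ^ (i : ℕ) * ∑ j, (sg (c (j - i)) : ℂ) * (v j : ℂ) =
     (∑ j : Fin n, (v j : ℂ) * η ^ (j : ℕ)) * ∑ j, (sg (c j) : ℂ) * η⁻¹ ^ (j : ℕ) := by
    simp only [Finset.mul_sum]
    rw [Finset.sum_comm]
    simp only [← Finset.mul_sum]
    rw [Finset.sum_mul]
    apply Finset.sum_congr rfl
    intro j _
    rw [← (Equiv.subLeft j).sum_comp (fun j => (sg (c j) : ℂ) * η⁻¹ ^ (j : ℕ)), Finset.mul_sum]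
    apply Finset.sum_congr rfl
    intro i _
    simp only [Equiv.subLeft_apply]
    have := pow_fin η h1 i j
    rw [← this, inv_pow]
    have : η ^ ((j - i : Fin n) : ℕ) ≠ 0 := pow_ne_zero _ h0
    field_simp
  rw [e] at key
  exact (mul_eq_zero.1 key).resolve_left h2

theorem tot_sq (d : ℕ) : d ≤ 2 * d.totient ^ 2 ∧ (Odd d → d ≤ d.totient ^ 2) := by
  induction d using Nat.recOnPosPrimePosCoprime with
  | zero => simp
  | one => simp
  | prime_pow p k hp hk =>
    obtain ⟨k, rfl⟩ : ∃ j, k = j + 1 := ⟨k - 1, by omega⟩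
    rw [Nat.totient_prime_pow_succ hp]
    have hpk : 1 ≤ p ^ k := Nat.one_le_pow _ _ hp.pos
    rcases hp.eq_two_or_odd' with rfl | ho
    · refine ⟨by simp; rw [pow_succ]; nlinarith, ?_⟩
      intro h
      exfalso
      rw [pow_succ] at h
      exact (Nat.not_even_iff_odd.2 h) (by simp)
    · have h3 : 3 ≤ p := by
        have := hp.two_le
        rcases ho with ⟨t, rfl⟩
        omega
      have : p ^ (k + 1) ≤ (p ^ k * (p - 1)) ^ 2 := by
        obtain ⟨t, rfl⟩ : ∃ t, p = t + 1 := ⟨p - 1, by omega⟩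
        simp only [Nat.add_sub_cancel]
        rw [pow_succ, mul_pow]
        have : t + 1 ≤ t ^ 2 := by nlinarith
        exact Nat.mul_le_mul (by nlinarith) this
      exact ⟨by omega, fun _ => this⟩
  | coprime a b ha hb hab iha ihb =>
    rw [Nat.totient_mul hab, mul_pow]
    constructor
    · rcases Nat.even_or_odd a with h | h
      · have hb' : Odd b := by
          by_contra hb'
          rw [Nat.not_odd_iff_even] at hb'
          exact Nat.not_coprime_of_dvd_of_dvd (by norm_num) h.two_dvd hb'.two_dvd hab
        calc a * b ≤ (2 * a.totient ^ 2) * b.totient ^ 2 := Nat.mul_le_mul iha.1 (ihb.2 hb')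
          _ = _ := by ring
      · calc a * b ≤ (a.totient ^ 2) * (2 * b.totient ^ 2) := Nat.mul_le_mul (iha.2 h) (ihb.1)
          _ = _ := by ring
    · intro h
      rw [Nat.odd_mul] at h
      exact Nat.mul_le_mul (iha.2 h.1) (ihb.2 h.2)

theorem cb_sq (k : ℕ) : (k.centralBinom : ℝ) ^ 2 * (2 * k + 1) ≤ (4 ^ k) ^ 2 := by
  induction k with
  | zero => simp
  | succ k ih =>
    have h := Nat.succ_mul_centralBinom_succ k
    have h' : ((k : ℝ) + 1) * ((k + 1).centralBinom : ℝ) = 2 * (2 * k + 1) * k.centralBinom := by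
      exact_mod_cast h
    have hk : (0 : ℝ) < (k : ℝ) + 1 := by positivity
    have e : ((k + 1).centralBinom : ℝ) = 2 * (2 * k + 1) * k.centralBinom / (k + 1) := by
      field_simp; linarith
    rw [e]
    push_cast
    rw [div_pow, div_mul_eq_mul_div, div_le_iff₀ (by positivity)]
    calc (2 * (2 * (k : ℝ) + 1) * k.centralBinom) ^ 2 * (2 * ((k : ℝ) + 1) + 1) 
        = ((k.centralBinom : ℝ) ^ 2 * (2 * k + 1)) * (4 * ((2 * (k : ℝ) + 1) * (2 * k + 3))) := by ring
      _ ≤ (4 ^ k) ^ 2 * (4 * (4 * ((k : ℝ) + 1) ^ 2)) := by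
        apply mul_le_mul ih _ (by positivity) (by positivity)
        nlinarith
      _ = _ := by ring

theorem B_sq (m : ℕ) : ((m.choose (m / 2) : ℝ) / 2 ^ m) ^ 2 ≤ 1 / (m + 1) := by
  rw [div_pow, div_le_div_iff₀ (by positivity) (by positivity), one_mul]
  rcases Nat.even_or_odd' m with ⟨k, rfl | rfl⟩
  · have := cb_sq k
    rw [Nat.centralBinom] at this
    rw [show 2 * k / 2 = k by omega]
    push_cast
    rw [pow_mul]
    norm_num at this ⊢
    exact this
  · have := cb_sq (k + 1)
    have e : (k + 1).centralBinom = 2 * (2 * k + 1).choose k := by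
      rw [Nat.centralBinom, show 2 * (k + 1) = (2 * k + 1) + 1 by ring, Nat.choose_succ_succ,
        Nat.choose_symm_half]; ring
    rw [e] at this
    rw [show (2 * k + 1) / 2 = k by omega]
    push_cast at this ⊢
    have e2 : ((2 : ℝ) ^ (2 * k + 1)) ^ 2 * 4 = (4 ^ (k + 1)) ^ 2 := by
      rw [show (4 : ℝ) = 2 ^ 2 by norm_num]; simp only [← pow_mul, ← pow_add]; congr 1; ring
    have : 0 ≤ ((2 * k + 1).choose k : ℝ) ^ 2 := by positivity
    nlinarith

theorem summ_g : Summable (fun d : ℕ => (d : ℝ) * d.totient * (3 / 4 : ℝ) ^ d.totient) := by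
  have hb : ∃ C : ℝ, ∀ x : ℕ, (x : ℝ) ^ 7 * (3 / 4 : ℝ) ^ x ≤ C := by
    have := tendsto_pow_const_mul_const_pow_of_lt_one 7 (r := (3 / 4 : ℝ)) (by norm_num) (by norm_num)
    obtain ⟨C, hC⟩ := this.bddAbove_range
    exact ⟨C, fun x => hC ⟨x, rfl⟩⟩
  obtain ⟨C, hC⟩ := hb
  have hC0 : 0 ≤ C := le_trans (by positivity) (hC 0)
  have hs : Summable (fun d : ℕ => 8 * C * (1 / (d : ℝ) ^ 2)) :=
    (Real.summable_one_div_nat_pow.2 (by norm_num)).mul_left _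
  refine Summable.of_nonneg_of_le (fun d => by positivity) (fun d => ?_) hs
  rcases Nat.eq_zero_or_pos d with rfl | hd
  · simp
  have h1 : (d : ℝ) ≤ 2 * (d.totient : ℝ) ^ 2 := by exact_mod_cast (tot_sq d).1
  have hd' : (0 : ℝ) < d := by exact_mod_cast hd
  have h3 : (d : ℝ) ^ 3 ≤ 8 * (d.totient : ℝ) ^ 6 := by
    calc (d : ℝ) ^ 3 ≤ (2 * (d.totient : ℝ) ^ 2) ^ 3 := by gcongr
      _ = _ := by ring
  rw [mul_one_div, le_div_iff₀ (by positivity)]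
  have := hC d.totient
  calc (d : ℝ) * d.totient * (3 / 4 : ℝ) ^ d.totient * d ^ 2 = (d : ℝ) ^ 3 * (d.totient * (3 / 4 : ℝ) ^ d.totient) := by ring
    _ ≤ 8 * (d.totient : ℝ) ^ 6 * (d.totient * (3 / 4 : ℝ) ^ d.totient) := by gcongr
    _ = 8 * ((d.totient : ℝ) ^ 7 * (3 / 4 : ℝ) ^ d.totient) := by ring
    _ ≤ 8 * C := by gcongr

theorem cb_asymp : Filter.Tendsto (fun k : ℕ => (k.centralBinom : ℝ) / 4 ^ k * Real.sqrt (Real.pi * k))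
    Filter.atTop (nhds 1) := by
  have h := Stirling.tendsto_stirlingSeq_sqrt_pi
  have h2 : Filter.Tendsto (fun k : ℕ => Stirling.stirlingSeq (2 * k)) Filter.atTop (nhds (Real.sqrt Real.pi)) :=
    h.comp (Filter.tendsto_id.const_mul_atTop' (by norm_num))
  have hpi : Real.sqrt Real.pi ≠ 0 := by positivity
  have h3 := (h2.mul_const (Real.sqrt Real.pi)).div (h.mul h) (mul_ne_zero hpi hpi)
  rw [div_self (mul_ne_zero hpi hpi)] at h3
  refine h3.congr' ?_
  filter_upwards [Filter.eventually_gt_atTop 0] with k hk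
  have hk' : (0 : ℝ) < k := by exact_mod_cast hk
  have e : (k.centralBinom : ℝ) * (k.factorial * k.factorial) = (2 * k).factorial := by
    rw [Nat.centralBinom]
    have := Nat.choose_mul_factorial_mul_factorial (show k ≤ 2 * k by omega)
    rw [show 2 * k - k = k by omega] at this
    rw [← mul_assoc]; exact_mod_cast this
  have e' : (k.centralBinom : ℝ) = (2 * k).factorial / (k.factorial * k.factorial) := by
    rw [← e]; field_simp
  simp only [Pi.div_apply, Stirling.stirlingSeq, e']
  push_cast
  rw [show (2 : ℝ) * (2 * k) = 2 ^ 2 * k by ring, Real.sqrt_mul (by positivity) (k : ℝ), Real.sqrt_sq (by norm_num), 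
    Real.sqrt_mul (by positivity) (k : ℝ), Real.sqrt_mul (by positivity) (k : ℝ)]
  have s2 := Real.mul_self_sqrt (show (0 : ℝ) ≤ 2 by norm_num)
  have sk := Real.mul_self_sqrt hk'.le
  have hs2 : Real.sqrt 2 ≠ 0 := by positivity
  have hsk : Real.sqrt k ≠ 0 := by positivity
  have h4 : (4 : ℝ) ^ k = 2 ^ (2 * k) := by rw [pow_mul]; norm_num
  rw [h4, div_pow, div_pow, mul_pow, pow_mul (k : ℝ) 2 k, pow_mul (Real.exp 1) 2 k, pow_right_comm (k : ℝ) 2 k,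
    pow_right_comm (Real.exp 1) 2 k]
  have : (k : ℝ) ^ k ≠ 0 := by positivity
  have hE : Real.exp 1 ^ k ≠ 0 := by positivity
  generalize Real.exp 1 ^ k = E at *
  field_simp
  exact Real.sq_sqrt (by norm_num)

noncomputable def ZS (n : ℕ) : Finset (Fin n → Bool) :=
  univ.filter (fun c => (Matrix.of fun i j : Fin n => (if c (j - i) then (1 : ℚ) else -1)).det = 0)

theorem PqPlus_half (n : ℕ) : PqPlus (1 / 2) n = ((ZS n).card : ℝ) / 2 ^ n := by
  have hw : ∀ c, bernWeight (1 / 2) n c = 1 / 2 ^ n := by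
    intro c
    unfold bernWeight
    have : (univ.filter (fun j => c j = true)).card ≤ n := by
      simpa using Finset.card_le_univ (univ.filter (fun j => c j = true))
    rw [show (1 : ℝ) - 1 / 2 = 1 / 2 by norm_num, ← pow_add, Nat.add_sub_cancel' this, one_div_pow]
  unfold PqPlus ZS
  simp only [hw]
  rw [← Finset.sum_filter, Finset.sum_const, nsmul_eq_mul, mul_one_div]

noncomputable def FS (n : ℕ) (ω : ℂ) : Finset (Fin n → Bool) :=
  univ.filter (fun c => ∑ j, (sg (c j) : ℂ) * ω ^ (j : ℕ) = 0)

theorem FS_card {n d : ℕ} (hd : 3 ≤ d) (hdn : d ∣ n) (hn : 0 < n) (ω : ℂ) (hω : IsPrimitiveRoot ω d) :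
    ((FS n ω).card : ℝ) / 2 ^ n ≤ 16 / 9 / n * (d * (3 / 4) ^ d.totient) := by
  obtain ⟨m, hm⟩ := hdn
  rw [mul_comm] at hm
  subst hm
  have hm0 : 0 < m := Nat.pos_of_mul_pos_right hn
  have h1 : ((FS (m * d) ω).card : ℝ) ≤ (m.choose (m / 2) : ℝ) ^ d.totient * (2 ^ m) ^ (d - d.totient) := by
    exact_mod_cast count_root (m := m) (by omega) ω hω
  set B : ℝ := (m.choose (m / 2) : ℝ) / 2 ^ m with hB
  have hB0 : 0 ≤ B := by positivity
  have hBs : B ^ 2 ≤ 1 / (m + 1) := B_sq m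
  have hm1 : (1 : ℝ) ≤ m := by exact_mod_cast hm0
  have hBm : B ^ 2 ≤ 1 / m := hBs.trans (one_div_le_one_div_of_le (by positivity) (by linarith))
  have hB2 : B ^ 2 ≤ 1 / 2 := hBs.trans (one_div_le_one_div_of_le (by positivity) (by linarith))
  have hB34 : B ≤ 3 / 4 := by nlinarith
  have htot : 2 ≤ d.totient := by
    have := Nat.totient_even (show 2 < d by omega)
    have h0 : 0 < d.totient := Nat.totient_pos.2 (by omega)
    rcases this with ⟨t, ht⟩
    omega
  have h2 : ((FS (m * d) ω).card : ℝ) / 2 ^ (m * d) ≤ B ^ d.totient := by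
    rw [div_le_iff₀ (by positivity)]
    refine h1.trans (le_of_eq ?_)
    rw [hB, div_pow, pow_mul, div_mul_eq_mul_div, mul_div_assoc]
    congr 1
    rw [eq_div_iff (by positivity), ← pow_add, Nat.sub_add_cancel (Nat.totient_le d)]
  refine h2.trans ?_
  obtain ⟨t, ht⟩ := Nat.exists_eq_add_of_le htot
  rw [ht]
  have hd0 : (0 : ℝ) < d := by exact_mod_cast (show 0 < d by omega)
  calc B ^ (2 + t) = B ^ 2 * B ^ t := pow_add _ _ _
    _ ≤ (1 / m) * (3 / 4) ^ t := by gcongr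
    _ = _ := by
      push_cast
      rw [pow_add]
      field_simp
      norm_num

theorem ZS_upper (k : ℕ) (hk : 0 < k) : ((ZS (2 * k)).card : ℝ) / 2 ^ (2 * k) ≤
    2 * (k.centralBinom / 4 ^ k) + (16 / 9 * ∑' d : ℕ, (d : ℝ) * d.totient * (3 / 4 : ℝ) ^ d.totient) / (2 * k) := by
  classical
  set n := 2 * k with hn
  have hn0 : 0 < n := by omega
  have : NeZero n := ⟨by omega⟩
  set A := univ.filter (fun c : Fin n → Bool => ∑ j, sg (c j) = 0) with hA
  set B := univ.filter (fun c : Fin n → Bool => ∑ j, sg (c j) * (-1) ^ (j : ℕ) = 0) with hB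
  set D := n.divisors.filter (fun d => 3 ≤ d) with hD
  have hsub : ZS n ⊆ (A ∪ B) ∪ D.biUnion (fun d => (primitiveRoots d ℂ).biUnion (fun ω => FS n ω)) := by
    intro c hc
    simp only [ZS, mem_filter, mem_univ, true_and] at hc
    obtain ⟨ω, h1, h2⟩ := exists_root c hc
    have hord := IsPrimitiveRoot.orderOf ω
    have hdvd : orderOf ω ∣ n := orderOf_dvd_of_pow_eq_one h1
    have hpos : 0 < orderOf ω := Nat.pos_of_dvd_of_pos hdvd hn0
    simp only [mem_union]
    by_cases h3 : 3 ≤ orderOf ω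
    · right
      rw [mem_biUnion]
      refine ⟨orderOf ω, ?_, ?_⟩
      · rw [hD, mem_filter, Nat.mem_divisors]
        exact ⟨⟨hdvd, by omega⟩, h3⟩
      · rw [mem_biUnion]
        exact ⟨ω, (mem_primitiveRoots hpos).2 hord, by simp [FS, h2]⟩
    · left
      have : orderOf ω = 1 ∨ orderOf ω = 2 := by omega
      rcases this with h | h
      · left
        rw [h] at hord
        have : ω = 1 := IsPrimitiveRoot.one_right_iff.1 hord
        rw [this] at h2
        simp only [one_pow, mul_one] at h2
        rw [hA, mem_filter]
        exact ⟨mem_univ _, by exact_mod_cast h2⟩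
      · right
        rw [h] at hord
        have : ω = -1 := hord.eq_neg_one_of_two_right
        rw [this] at h2
        rw [hB, mem_filter]
        exact ⟨mem_univ _, by exact_mod_cast h2⟩
  have hcard : (ZS n).card ≤ (k.centralBinom + k.centralBinom) + ∑ d ∈ D, ∑ ω ∈ primitiveRoots d ℂ, (FS n ω).card := by
    refine (card_le_card hsub).trans ((card_union_le _ _).trans (add_le_add ((card_union_le _ _).trans ?_) ?_))
    · exact (congrArg₂ (· + ·) card_zero card_zero_alt).le
    · exact card_biUnion_le.trans (sum_le_sum (fun d _ => card_biUnion_le))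
  have hcard' : ((ZS n).card : ℝ) ≤ (k.centralBinom + k.centralBinom) + ∑ d ∈ D, ∑ ω ∈ primitiveRoots d ℂ, ((FS n ω).card : ℝ) := by
    exact_mod_cast hcard
  have h4 : (2 : ℝ) ^ n = 4 ^ k := by rw [hn, pow_mul]; norm_num
  have hsum : (∑ d ∈ D, ∑ ω ∈ primitiveRoots d ℂ, ((FS n ω).card : ℝ)) / 2 ^ n ≤
      (16 / 9 * ∑' d : ℕ, (d : ℝ) * d.totient * (3 / 4 : ℝ) ^ d.totient) / (2 * k) := by
    rw [Finset.sum_div]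
    calc _ ≤ ∑ d ∈ D, 16 / 9 / (n : ℝ) * ((d : ℝ) * d.totient * (3 / 4 : ℝ) ^ d.totient) := by
          apply sum_le_sum
          intro d hd
          rw [hD, mem_filter, Nat.mem_divisors] at hd
          rw [Finset.sum_div]
          refine (Finset.sum_le_card_nsmul _ _ (16 / 9 / (n : ℝ) * ((d : ℝ) * (3 / 4 : ℝ) ^ d.totient)) ?_).trans (le_of_eq ?_)
          · intro ω hω
            exact FS_card hd.2 hd.1.1 hn0 ω ((mem_primitiveRoots (by omega)).1 hω)
          · rw [Complex.card_primitiveRoots, nsmul_eq_mul]; ring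
      _ = 16 / 9 / (n : ℝ) * ∑ d ∈ D, ((d : ℝ) * d.totient * (3 / 4 : ℝ) ^ d.totient) := by
          rw [Finset.mul_sum]
      _ ≤ 16 / 9 / (n : ℝ) * ∑' d : ℕ, ((d : ℝ) * d.totient * (3 / 4 : ℝ) ^ d.totient) := by
          apply mul_le_mul_of_nonneg_left _ (by positivity)
          exact summ_g.sum_le_tsum _ (fun d _ => by positivity)
      _ = _ := by rw [hn]; push_cast; ring
  calc ((ZS n).card : ℝ) / 2 ^ n ≤ ((k.centralBinom + k.centralBinom) + ∑ d ∈ D, ∑ ω ∈ primitiveRoots d ℂ, ((FS n ω).card : ℝ)) / 2 ^ n := by gcongr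
    _ = 2 * (k.centralBinom / 4 ^ k) + (∑ d ∈ D, ∑ ω ∈ primitiveRoots d ℂ, ((FS n ω).card : ℝ)) / 2 ^ n := by
      rw [add_div, h4]; ring
    _ ≤ _ := by gcongr

theorem ZS_lower (k : ℕ) (hk : 0 < k) : 2 * (k.centralBinom / 4 ^ k : ℝ) - 2 / (2 * k) ≤
    ((ZS (2 * k)).card : ℝ) / 2 ^ (2 * k) := by
  have : NeZero (2 * k) := ⟨by omega⟩
  set A := univ.filter (fun c : Fin (2 * k) → Bool => ∑ j, sg (c j) = 0) with hA
  set B := univ.filter (fun c : Fin (2 * k) → Bool => ∑ j, sg (c j) * (-1) ^ (j : ℕ) = 0) with hB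
  have hsub : A ∪ B ⊆ ZS (2 * k) := by
    intro c hc
    simp only [ZS, mem_filter, mem_univ, true_and]
    rw [mem_union, hA, hB, mem_filter, mem_filter] at hc
    rcases hc with ⟨_, h⟩ | ⟨_, h⟩
    · apply det_zero_of c 1 (by simp)
      simp only [one_pow, mul_one]
      exact_mod_cast h
    · apply det_zero_of c (-1) (by simp [pow_mul])
      exact_mod_cast h
  have hAB : (A ∩ B).card ≤ (k.choose (k / 2)) ^ 2 := by
    have h := count_both (m := k)
    rw [mul_comm k 2] at h
    rw [hA, hB, ← filter_and]
    exact h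
  have h1 := card_union_add_card_inter A B
  have hAc : A.card = k.centralBinom := card_zero
  have hBc : B.card = k.centralBinom := card_zero_alt
  have h2 := card_le_card hsub
  have h3 : k.centralBinom + k.centralBinom ≤ (ZS (2 * k)).card + (k.choose (k / 2)) ^ 2 := by omega
  have h3' : (k.centralBinom : ℝ) + k.centralBinom ≤ (ZS (2 * k)).card + (k.choose (k / 2) : ℝ) ^ 2 := by exact_mod_cast h3
  have h4 : (2 : ℝ) ^ (2 * k) = 4 ^ k := by rw [pow_mul]; norm_num
  have hk' : (0 : ℝ) < k := by exact_mod_cast hk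
  have h5 : (k.choose (k / 2) : ℝ) ^ 2 / 4 ^ k ≤ 1 / k := by
    have := B_sq k
    rw [div_pow, ← pow_mul, mul_comm k 2, h4] at this
    exact this.trans (one_div_le_one_div_of_le hk' (by linarith))
  have h6 : ((k.centralBinom : ℝ) + k.centralBinom) / 4 ^ k ≤ ((ZS (2 * k)).card + (k.choose (k / 2) : ℝ) ^ 2) / 4 ^ k := by gcongr
  rw [add_div, add_div] at h6
  rw [h4, show (2 : ℝ) / (2 * k) = 1 / k by field_simp]
  linarith

theorem even_lim : Filter.Tendsto
    (fun k : ℕ => PqPlus (1 / 2) (2 * k) * Real.sqrt (Real.pi * (2 * k : ℕ)) / (2 * Real.sqrt 2))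
    Filter.atTop (nhds 1) := by
  set C : ℝ := 16 / 9 * ∑' d : ℕ, (d : ℝ) * d.totient * (3 / 4 : ℝ) ^ d.totient with hC
  have he : ∀ k : ℕ, Real.sqrt (Real.pi * (2 * k : ℕ)) = Real.sqrt 2 * Real.sqrt (Real.pi * k) := by
    intro k
    rw [← Real.sqrt_mul (by norm_num)]; congr 1; push_cast; ring
  have h2 : Real.sqrt 2 ≠ 0 := by positivity
  have hz : Filter.Tendsto (fun k : ℕ => Real.sqrt (Real.pi * k) / k) Filter.atTop (nhds 0) := by
    have h1 : Filter.Tendsto (fun k : ℕ => Real.sqrt (Real.pi * (k : ℝ)⁻¹)) Filter.atTop (nhds 0) := by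
      have := ((tendsto_inv_atTop_nhds_zero_nat (𝕜 := ℝ)).const_mul Real.pi).sqrt
      simpa using this
    refine h1.congr ?_
    intro k
    rw [Real.sqrt_mul Real.pi_pos.le, Real.sqrt_mul Real.pi_pos.le, Real.sqrt_inv, mul_div_assoc, Real.sqrt_div_self]
  have lo := cb_asymp.sub (hz.mul_const (1 / 2))
  have hi := cb_asymp.add (hz.mul_const (C / 4))
  simp only [zero_mul, sub_zero, add_zero] at lo hi
  refine tendsto_of_tendsto_of_tendsto_of_le_of_le' lo hi ?_ ?_
  · filter_upwards [Filter.eventually_gt_atTop 0] with k hk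
    have := ZS_lower k hk
    rw [PqPlus_half, he]
    set s := Real.sqrt (Real.pi * k)
    have hs : 0 ≤ s := Real.sqrt_nonneg _
    have hk' : (0 : ℝ) < k := by exact_mod_cast hk
    calc _ = (2 * (k.centralBinom / 4 ^ k : ℝ) - 2 / (2 * k)) * (s / 2) := by field_simp
      _ ≤ _ * (s / 2) := mul_le_mul_of_nonneg_right this (by positivity)
      _ = _ := by field_simp
  · filter_upwards [Filter.eventually_gt_atTop 0] with k hk
    have := ZS_upper k hk
    rw [← hC] at this
    rw [PqPlus_half, he]
    set s := Real.sqrt (Real.pi * k)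
    have hs : 0 ≤ s := Real.sqrt_nonneg _
    have hk' : (0 : ℝ) < k := by exact_mod_cast hk
    calc _ = ((ZS (2 * k)).card : ℝ) / 2 ^ (2 * k) * (s / 2) := by field_simp
      _ ≤ (2 * (k.centralBinom / 4 ^ k : ℝ) + C / (2 * k)) * (s / 2) := mul_le_mul_of_nonneg_right this (by positivity)
      _ = _ := by field_simp; ring

/-- Corollary (signed case, q = 1/2, even n):
P_{1/2}^+(n) ∼ 2√2/√(πn) as n → ∞ through even integers n. -/
theorem PqPlus_half_asymptotic_even :
    Filter.Tendsto
      (fun n : ℕ =>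
        PqPlus (1 / 2) n * Real.sqrt (Real.pi * n) / (2 * Real.sqrt 2))
      (Filter.atTop ⊓ Filter.principal {n : ℕ | Even n}) (nhds 1) := by
  have hdiv : Filter.Tendsto (fun n : ℕ => n / 2) (Filter.atTop ⊓ Filter.principal {n : ℕ | Even n}) Filter.atTop :=
    (Nat.tendsto_div_const_atTop (by norm_num)).mono_left inf_le_left
  refine (even_lim.comp hdiv).congr' ?_
  have : ∀ᶠ n in (Filter.atTop ⊓ Filter.principal {n : ℕ | Even n}), Even n :=
    Filter.Eventually.filter_mono inf_le_right (Filter.mem_principal_self _)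
  filter_upwards [this] with n hn
  simp only [Function.comp]
  rw [Nat.two_mul_div_two_of_even hn]
end

section
/- Let q ∈ (0,1) be fixed and let m : ℕ → ℕ be a function with m(n) ≥ 1 and m(n) = O(√n) (i.e., there is a constant A with m(n) ≤ A·√n for all sufficiently large n). Then ∑_{k=0}^{n} φ_q(k,n)^{m(n)} = Θ((2πq(1−q)n)^{−(m(n)−1)/2} / √(m(n))) as n → ∞; i.e., there exist constants C₁, C₂, N > 0 such that C₁ ≤ (∑_{k=0}^{n} φ_q(k,n)^{m(n)}) · (2πq(1−q)n)^{(m(n)−1)/2} · √(m(n)) ≤ C₂ for all n > N. -/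
open Finset

open Filter Topology in
lemma aux_stirling_upper (n : ℕ) (hn : 1 ≤ n) :
    Real.log (Stirling.stirlingSeq n) ≤ Real.log Real.pi / 2 + 1 / n := by
  have hmono : Monotone (fun n : ℕ => Real.log (Stirling.stirlingSeq (n + 1)) - 1 / ((n : ℝ) + 1)) := by
    apply monotone_nat_of_le_succ
    intro n
    have h := Stirling.log_stirlingSeq_sdiff_le (n + 1)
    have h2 : (1 : ℝ) / (12 * ((n + 1 : ℕ) : ℝ) * (((n + 1 : ℕ) : ℝ) + 1)) ≤ 1 / ((n : ℝ) + 1) - 1 / ((n : ℝ) + 1 + 1) := by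
      have hn : (0 : ℝ) ≤ n := Nat.cast_nonneg n
      rw [div_sub_div _ _ (by positivity) (by positivity), div_le_div_iff₀ (by positivity) (by positivity)]
      push_cast
      nlinarith [mul_nonneg hn hn]
    push_cast at *
    linarith
  have ht : Tendsto (fun n : ℕ => Real.log (Stirling.stirlingSeq (n + 1)) - 1 / ((n : ℝ) + 1)) atTop
      (𝓝 (Real.log (√Real.pi) - 0)) := by
    apply Tendsto.sub
    · have h1 := (Stirling.tendsto_stirlingSeq_sqrt_pi.comp (tendsto_add_atTop_nat 1))
      exact h1.log (by positivity)
    · exact tendsto_one_div_add_atTop_nhds_zero_nat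
  have h := hmono.ge_of_tendsto ht (n - 1)
  have h3 : n - 1 + 1 = n := by omega
  have h4 : ((n - 1 : ℕ) : ℝ) + 1 = n := by exact_mod_cast h3
  simp only [h3, h4] at h
  rw [Real.log_sqrt Real.pi_pos.le] at h
  linarith

lemma aux_stirling_lower (n : ℕ) (hn : 1 ≤ n) :
    Real.log Real.pi / 2 ≤ Real.log (Stirling.stirlingSeq n) := by
  rw [← Real.log_sqrt Real.pi_pos.le]
  exact Real.log_le_log (by positivity) (Stirling.sqrt_pi_le_stirlingSeq (by omega))

lemma aux_log_fact (n : ℕ) (hn : 1 ≤ n) :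
    Real.log (n.factorial) = Real.log (Stirling.stirlingSeq n) + (Real.log 2 + Real.log n) / 2
      + n * Real.log n - n := by
  have h := Stirling.log_stirlingSeq_formula n
  have hn0 : (n : ℝ) ≠ 0 := by positivity
  rw [Real.log_div hn0 (Real.exp_pos 1).ne', Real.log_exp, Real.log_mul (by norm_num) hn0] at h
  rw [h]; ring

lemma aux_phi_pos (q : ℝ) (hq0 : 0 < q) (hq1 : q < 1) (k n : ℕ) (hk : k ≤ n) : 0 < phi q k n := by
  unfold phi
  have : 0 < 1 - q := by linarith
  have : 0 < n.choose k := Nat.choose_pos hk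
  positivity

lemma aux_log_phi (q : ℝ) (hq0 : 0 < q) (hq1 : q < 1) (k j n : ℕ) (hk : 1 ≤ k) (hj : 1 ≤ j)
    (hn : k + j = n) :
    Real.log (phi q k n * √(2 * Real.pi * q * (1 - q) * n)) =
      (Real.log (Stirling.stirlingSeq n) - Real.log Real.pi / 2)
      - (Real.log (Stirling.stirlingSeq k) - Real.log Real.pi / 2)
      - (Real.log (Stirling.stirlingSeq j) - Real.log Real.pi / 2)
      - (k + 1 / 2) * Real.log (k / (n * q)) - (j + 1 / 2) * Real.log (j / (n * (1 - q))) := by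
  have hp : 0 < 1 - q := by linarith
  have hk0 : (0 : ℝ) < k := by exact_mod_cast hk
  have hj0 : (0 : ℝ) < j := by exact_mod_cast hj
  have hn1 : (n : ℝ) = k + j := by exact_mod_cast hn.symm
  have hn0 : (0 : ℝ) < n := by linarith
  have hpi := Real.pi_pos
  have hphi := aux_phi_pos q hq0 hq1 k n (by omega)
  have hch : Real.log (n.choose k) = Real.log n.factorial - Real.log k.factorial
      - Real.log j.factorial := by
    have := Nat.choose_mul_factorial_mul_factorial (show k ≤ n by omega)
    rw [show n - k = j by omega] at this
    rw [← this]
    have : 0 < n.choose k := Nat.choose_pos (by omega)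
    push_cast
    rw [Real.log_mul (by positivity) (by positivity), Real.log_mul (by positivity) (by positivity)]
    ring
  have hchp : 0 < n.choose k := Nat.choose_pos (by omega)
  rw [Real.log_mul hphi.ne' (by positivity), Real.log_sqrt (by positivity), phi,
    show n - k = j by omega, Real.log_mul (by positivity) (by positivity),
    Real.log_mul (by positivity) (by positivity), Real.log_pow, Real.log_pow, hch,
    aux_log_fact n (by omega), aux_log_fact k hk, aux_log_fact j hj,
    Real.log_div (by positivity) (by positivity), Real.log_div (by positivity) (by positivity),
    Real.log_mul (by positivity) (by positivity), Real.log_mul (by positivity) (by positivity),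
    Real.log_mul (by positivity) (by positivity), Real.log_mul (by positivity) (by positivity),
    Real.log_mul (by positivity) (by positivity), Real.log_mul (by positivity) (by positivity)]
  generalize Real.log (n : ℝ) = ln
  rw [hn1]
  ring

lemma aux_h (a : ℝ) (ha : 0 < a) : a - 1 + (a - 1) ^ 2 / (2 * (a + 1)) ≤ a * Real.log a := by
  obtain ⟨s, hs, rfl⟩ : ∃ s : ℝ, 0 < s ∧ a = s ^ 2 := ⟨√a, by positivity, by rw [Real.sq_sqrt ha.le]⟩
  have h1 : Real.log (s ^ 2) = 2 * Real.log s := by rw [Real.log_pow]; norm_num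
  have h2 := Real.one_sub_inv_le_log_of_pos hs
  have h3 : s ^ 2 * (2 * (1 - s⁻¹)) ≤ s ^ 2 * Real.log (s ^ 2) := by
    rw [h1]; gcongr
  refine le_trans ?_ h3
  have h4 : s ^ 2 * (2 * (1 - s⁻¹)) = 2 * s ^ 2 - 2 * s := by field_simp
  rw [h4]
  have h5 : (s ^ 2 - 1) ^ 2 / (2 * (s ^ 2 + 1)) ≤ (s - 1) ^ 2 := by
    rw [div_le_iff₀ (by positivity)]
    nlinarith [mul_nonneg (sq_nonneg (s - 1)) (sq_nonneg (s - 1))]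
  nlinarith

lemma aux_half (q : ℝ) (hq0 : 0 < q) (hq1 : q < 1) :
    ∃ N : ℕ, ∀ n : ℕ, N ≤ n → ∀ k : ℕ, 1 ≤ k → k ≤ n →
      (k - n * q : ℝ) + (k - n * q) ^ 2 / (8 * n) - (8 / q ^ 2) / n ≤
        (k + 1 / 2) * Real.log (k / (n * q)) := by
  have hlog : ∀ᶠ n : ℕ in Filter.atTop, Real.log n ≤ q ^ 2 / 16 * n := by
    have h := Real.isLittleO_log_id_atTop.comp_tendsto tendsto_natCast_atTop_atTop
    have h2 := h.bound (show 0 < q ^ 2 / 16 by positivity)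
    filter_upwards [h2] with n hn
    simp only [Function.comp, id, Real.norm_eq_abs, Nat.abs_cast] at hn
    exact (le_abs_self _).trans hn
  obtain ⟨N, hN⟩ := Filter.eventually_atTop.1 hlog
  refine ⟨N, fun n hn k hk hkn => ?_⟩
  have hl := hN n hn
  have hk0 : (1 : ℝ) ≤ k := by exact_mod_cast hk
  have hkn' : (k : ℝ) ≤ n := by exact_mod_cast hkn
  have hn0 : (0 : ℝ) < n := by linarith
  obtain ⟨a, ha⟩ : ∃ a : ℝ, a = k / (n * q) := ⟨_, rfl⟩
  have hka : (k : ℝ) = n * q * a := by rw [ha]; field_simp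
  have ha0 : 0 < a := by rw [ha]; positivity
  have hqa : q * a ≤ 1 := by
    have : (n : ℝ) * (q * a) ≤ n * 1 := by nlinarith
    exact le_of_mul_le_mul_left this hn0
  rw [← ha]
  have h1 : (k - n * q : ℝ) + (k - n * q) ^ 2 / (4 * n) ≤ k * Real.log a := by
    have h := aux_h a ha0
    have h2 : q * (a - 1) ^ 2 / 4 ≤ (a - 1) ^ 2 / (2 * (a + 1)) := by
      rw [div_le_div_iff₀ (by norm_num) (by positivity)]
      nlinarith [mul_nonneg (sq_nonneg (a - 1)) (show 0 ≤ 2 - (q * a + q) by linarith)]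
    have h3 : n * q * (a - 1 + q * (a - 1) ^ 2 / 4) ≤ n * q * (a * Real.log a) := by
      gcongr; linarith
    rw [hka]
    refine le_trans (le_of_eq ?_) (h3.trans (le_of_eq ?_))
    · field_simp
    · ring
  have h2 : - Real.log a ≤ (16 / q ^ 2) / n + (q ^ 2 / 4) * n * (1 - a) ^ 2 := by
    by_cases hc : 1 / 2 ≤ a
    · have h3 := Real.one_sub_inv_le_log_of_pos ha0
      have h4 : a⁻¹ - 1 ≤ 2 * |1 - a| := by
        have : a⁻¹ - 1 = (1 - a) / a := by field_simp
        rw [this, div_le_iff₀ ha0]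
        nlinarith [le_abs_self (1 - a), abs_nonneg (1 - a)]
      have h5 : 2 * |1 - a| ≤ (16 / q ^ 2) / n + (q ^ 2 / 16) * n * (1 - a) ^ 2 := by
        rw [← sq_abs (1 - a)]
        generalize |1 - a| = y
        have h6 : (16 / q ^ 2) / n + (q ^ 2 / 16) * n * y ^ 2 - 2 * y
          = (q ^ 2 * n / 16) * (y - 16 / (q ^ 2 * n)) ^ 2 := by field_simp; ring
        have : 0 ≤ (q ^ 2 * n / 16) * (y - 16 / (q ^ 2 * n)) ^ 2 := by positivity
        linarith
      have h7 : 0 ≤ q ^ 2 * n * (1 - a) ^ 2 := by positivity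
      nlinarith
    · push Not at hc
      have h3 : - Real.log a ≤ Real.log n := by
        rw [← Real.log_inv]
        apply Real.log_le_log (by positivity)
        rw [ha, inv_div, div_le_iff₀ (by positivity)]
        nlinarith
      have h4 : 1 ≤ 4 * (1 - a) ^ 2 := by nlinarith
      have h5 : q ^ 2 / 16 * n * 1 ≤ q ^ 2 / 16 * n * (4 * (1 - a) ^ 2) := by gcongr
      have h6 : 0 ≤ (16 / q ^ 2) / n := by positivity
      linarith
  have h3 : (q ^ 2 / 4) * n * (1 - a) ^ 2 = (k - n * q) ^ 2 / (4 * n) := by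
    rw [hka]; field_simp; ring
  have h4 : (k - n * q : ℝ) ^ 2 / (8 * n) = (k - n * q) ^ 2 / (4 * n) / 2 := by field_simp; ring
  have h5 : (8 / q ^ 2) / (n : ℝ) = (16 / q ^ 2) / n / 2 := by field_simp; ring
  rw [h3] at h2
  rw [h4, h5]
  linarith

lemma aux_upper (q : ℝ) (hq0 : 0 < q) (hq1 : q < 1) :
    ∃ C : ℝ, 0 < C ∧ ∃ N : ℕ, ∀ n : ℕ, N ≤ n → ∀ k : ℕ, 1 ≤ k → k + 1 ≤ n →
      Real.log (phi q k n * √(2 * Real.pi * q * (1 - q) * n)) ≤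
        C / n - (k - n * q) ^ 2 / (4 * n) := by
  have hp : 0 < 1 - q := by linarith
  obtain ⟨N1, h1⟩ := aux_half q hq0 hq1
  obtain ⟨N2, h2⟩ := aux_half (1 - q) hp (by linarith)
  refine ⟨1 + 8 / q ^ 2 + 8 / (1 - q) ^ 2, by positivity, max N1 N2, fun n hn k hk hkn => ?_⟩
  obtain ⟨j, rfl⟩ : ∃ j, n = k + j := ⟨n - k, by omega⟩
  have hj : 1 ≤ j := by omega
  rw [aux_log_phi q hq0 hq1 k j _ hk hj rfl]
  have a1 := h1 _ (le_trans (le_max_left _ _) hn) k hk (by omega)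
  have a2 := h2 _ (le_trans (le_max_right _ _) hn) j hj (by omega)
  have a3 := aux_stirling_upper (k + j) (by omega)
  have a4 := aux_stirling_lower k hk
  have a5 := aux_stirling_lower j hj
  have hx : (j : ℝ) - (k + j : ℕ) * (1 - q) = - (k - (k + j : ℕ) * q) := by push_cast; ring
  rw [hx] at a2
  generalize (k : ℝ) - (k + j : ℕ) * q = x at *
  have hn0 : ((k + j : ℕ) : ℝ) ≠ 0 := by positivity
  generalize ((k + j : ℕ) : ℝ) = n at *
  have e1 : (1 + 8 / q ^ 2 + 8 / (1 - q) ^ 2) / n = 1 / n + (8 / q ^ 2) / n + (8 / (1 - q) ^ 2) / n := by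
    ring
  have e2 : x ^ 2 / (4 * n) = 2 * (x ^ 2 / (8 * n)) := by field_simp; ring
  rw [e1, e2]
  rw [neg_sq] at a2
  linarith

lemma aux_half_lower (q n k : ℝ) (hq0 : 0 < q) (hn : 0 < n) (hk : 0 < k) :
    (k + 1 / 2) * Real.log (k / (n * q)) ≤ (k - n * q) + (2 * (k - n * q) ^ 2 + 1) / (n * q) := by
  have h := Real.log_le_sub_one_of_pos (show 0 < k / (n * q) by positivity)
  have h2 : (k + 1 / 2) * Real.log (k / (n * q)) ≤ (k + 1 / 2) * (k / (n * q) - 1) := by gcongr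
  refine h2.trans ?_
  have e : k - n * q + (2 * (k - n * q) ^ 2 + 1) / (n * q) - (k + 1 / 2) * (k / (n * q) - 1)
      = ((k - n * q) ^ 2 - (k - n * q) / 2 + 1) / (n * q) := by field_simp; ring
  have : 0 ≤ ((k - n * q) ^ 2 - (k - n * q) / 2 + 1) / (n * q) := by
    apply div_nonneg _ (by positivity)
    nlinarith [sq_nonneg ((k - n * q) - 1 / 4)]
  linarith

lemma aux_lower (q : ℝ) (hq0 : 0 < q) (hq1 : q < 1) (k j n : ℕ) (hk : 1 ≤ k) (hj : 1 ≤ j)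
    (hn : k + j = n) (hkq : (n * q / 2 : ℝ) ≤ k) (hjq : (n * (1 - q) / 2 : ℝ) ≤ j) :
    - ((3 / q + 3 / (1 - q)) * ((1 + (k - n * q) ^ 2) / n)) ≤
      Real.log (phi q k n * √(2 * Real.pi * q * (1 - q) * n)) := by
  have hp : 0 < 1 - q := by linarith
  have hk0 : (0 : ℝ) < k := by exact_mod_cast hk
  have hj0 : (0 : ℝ) < j := by exact_mod_cast hj
  have hn1 : (n : ℝ) = k + j := by exact_mod_cast hn.symm
  have hn0 : (0 : ℝ) < n := by linarith
  rw [aux_log_phi q hq0 hq1 k j _ hk hj hn]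
  have a1 := aux_half_lower q n k hq0 hn0 hk0
  have a2 := aux_half_lower (1 - q) n j hp hn0 hj0
  have a3 := aux_stirling_lower n (by omega)
  have a4 := aux_stirling_upper k hk
  have a5 := aux_stirling_upper j hj
  have b4 : 1 / (k : ℝ) ≤ 2 / (n * q) := by
    rw [div_le_div_iff₀ hk0 (by positivity)]; linarith
  have b5 : 1 / (j : ℝ) ≤ 2 / (n * (1 - q)) := by
    rw [div_le_div_iff₀ hj0 (by positivity)]; linarith
  have hx : (j : ℝ) - n * (1 - q) = - (k - n * q) := by rw [hn1]; ring
  rw [hx, neg_sq] at a2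
  generalize (k : ℝ) - n * q = x at *
  have e : (3 / q + 3 / (1 - q)) * ((1 + x ^ 2) / n) =
     2 / (n * q) + 2 / (n * (1 - q)) + (2 * x ^ 2 + 1) / (n * q) + (2 * x ^ 2 + 1) / (n * (1 - q))
     + x ^ 2 / (n * q) + x ^ 2 / (n * (1 - q)) := by field_simp; ring
  have : 0 ≤ x ^ 2 / (n * q) := by positivity
  have : 0 ≤ x ^ 2 / (n * (1 - q)) := by positivity
  linarith

lemma aux_geom (t : ℝ) (ht : 0 < t) (ht1 : t ≤ 1) (M : ℕ) :
    ∑ i ∈ Finset.range M, Real.exp (-(t * i)) ≤ 2 / t := by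
  have h : ∀ i : ℕ, Real.exp (-(t * i)) = (Real.exp (-t)) ^ i := by
    intro i; rw [← Real.exp_nat_mul]; congr 1; ring
  simp_rw [h]
  have h1 : Real.exp (-t) < 1 := by rw [Real.exp_lt_one_iff]; linarith
  have h2 : Real.exp (-t) ≤ 1 - t / 2 := by
    rw [Real.exp_neg, inv_le_comm₀ (Real.exp_pos _) (by linarith)]
    have := Real.add_one_le_exp t
    refine le_trans ?_ this
    rw [inv_le_iff_one_le_mul₀ (by linarith)]
    nlinarith
  have h3 : ∑ i ∈ Finset.range M, (Real.exp (-t)) ^ i ≤ (1 - Real.exp (-t))⁻¹ := by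
    rw [← tsum_geometric_of_lt_one (Real.exp_pos _).le h1]
    exact (summable_geometric_of_lt_one (Real.exp_pos _).le h1).sum_le_tsum _
      (fun i _ => by positivity)
  refine h3.trans ?_
  rw [show 2 / t = (t / 2)⁻¹ by rw [inv_div]]
  exact inv_anti₀ (by linarith) (by linarith)

lemma aux_gauss (t μ : ℝ) (ht : 0 < t) (ht1 : t ≤ 1) (n : ℕ) (hμ : 0 ≤ μ) (hμn : μ ≤ n) :
    ∑ k ∈ Finset.range (n + 1), Real.exp (-((t * (k - μ)) ^ 2)) ≤ 12 / t := by
  obtain ⟨K, hK⟩ : ∃ K, K = ⌊μ⌋₊ := ⟨_, rfl⟩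
  have hK1 : (K : ℝ) ≤ μ := hK ▸ Nat.floor_le hμ
  have hK2 : μ < K + 1 := hK ▸ Nat.lt_floor_add_one μ
  have hKn : K ≤ n := by exact_mod_cast hK1.trans hμn
  have key : ∀ y z : ℝ, 0 ≤ y → y ≤ |z| → Real.exp (-((t * z) ^ 2)) ≤ 3 * Real.exp (-(t * y)) := by
    intro y z hy hyz
    have h1 : -((t * z) ^ 2) ≤ 1 + -(t * y) := by
      have : t * y ≤ t * |z| := by gcongr
      rw [mul_pow, ← sq_abs z]
      nlinarith [sq_nonneg (t * |z| - 1 / 2)]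
    have h2 := Real.exp_le_exp.2 h1
    rw [Real.exp_add] at h2
    have := Real.exp_one_lt_d9
    refine h2.trans ?_
    gcongr
    linarith
  rw [show n + 1 = (K + 1) + (n - K) by omega, Finset.sum_range_add]
  have s1 : ∑ k ∈ Finset.range (K + 1), Real.exp (-((t * (k - μ)) ^ 2)) ≤ 3 * (2 / t) := by
    rw [← Finset.sum_range_reflect]
    refine le_trans ?_ (mul_le_mul_of_nonneg_left (aux_geom t ht ht1 (K + 1)) (by norm_num))
    rw [Finset.mul_sum]
    apply Finset.sum_le_sum
    intro i hi
    have hi := Finset.mem_range.1 hi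
    apply key _ _ (Nat.cast_nonneg _)
    rw [show K + 1 - 1 - i = K - i by omega, Nat.cast_sub (by omega), abs_sub_comm]
    refine le_trans ?_ (le_abs_self _)
    linarith
  have s2 : ∑ i ∈ Finset.range (n - K), Real.exp (-((t * ((K + 1 + i : ℕ) - μ)) ^ 2)) ≤ 3 * (2 / t) := by
    refine le_trans ?_ (mul_le_mul_of_nonneg_left (aux_geom t ht ht1 (n - K)) (by norm_num))
    rw [Finset.mul_sum]
    apply Finset.sum_le_sum
    intro i hi
    apply key _ _ (Nat.cast_nonneg _)
    refine le_trans ?_ (le_abs_self _)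
    push_cast
    linarith
  have : 12 / t = 3 * (2 / t) + 3 * (2 / t) := by ring
  linarith
lemma aux_factor (s c S n : ℝ) (m : ℕ) (hc : 0 < c) (hn : 0 < n) (hs : s = √(c * n)) :
    S * (c * n) ^ (((m : ℝ) - 1) / 2) * √(m : ℝ) = S * s ^ m * (√(m : ℝ) / s) := by
  have hs0 : 0 < s := by rw [hs]; positivity
  have h1 : (c * n) ^ (((m : ℝ) - 1) / 2) = s ^ m / s := by
    have h2 : s ^ m / s = s ^ ((m : ℝ) - 1) := by
      rw [Real.rpow_sub hs0, Real.rpow_natCast, Real.rpow_one]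
    rw [h2, hs, Real.sqrt_eq_rpow, ← Real.rpow_mul (by positivity)]
    congr 1
    ring
  rw [h1]
  ring

lemma aux_final_upper (q C s c : ℝ) (hq0 : 0 < q) (hq1 : q < 1) (n m : ℕ) (hm : 1 ≤ m) (hmn : m ≤ n)
    (hC : 0 < C) (hc : 0 < c) (hs : s = √(c * n))
    (h : ∀ k : ℕ, 1 ≤ k → k + 1 ≤ n →
      Real.log (phi q k n * s) ≤ C / n - (k - n * q) ^ 2 / (4 * n))
    (h0 : (1 - q) ^ n * s ≤ 1) (h1 : q ^ n * s ≤ 1) :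
    (∑ k ∈ Finset.range (n + 1), phi q k n ^ m) * s ^ m * (√(m : ℝ) / s) ≤
      (12 * Real.exp C + 2) * (2 / √c) := by
  have hp : 0 < 1 - q := by linarith
  have hm0 : (0 : ℝ) < m := by exact_mod_cast hm
  have hmn' : (m : ℝ) ≤ n := by exact_mod_cast hmn
  have hn0 : (0 : ℝ) < n := by linarith
  have hs0 : 0 < s := by rw [hs]; positivity
  obtain ⟨t, ht⟩ : ∃ t : ℝ, t = √(m / (4 * n)) := ⟨_, rfl⟩
  have ht0 : 0 < t := by rw [ht]; positivity
  have ht2 : t ^ 2 = m / (4 * n) := by rw [ht, Real.sq_sqrt (by positivity)]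
  have ht1 : t ≤ 1 := by
    rw [ht, Real.sqrt_le_one]
    rw [div_le_one (by positivity)]; linarith
  have hr : √(m : ℝ) / s = t * (2 / √c) := by
    have : √(m : ℝ) = 2 * t * √n := by
      rw [Real.sqrt_eq_iff_mul_self_eq (by positivity) (by positivity)]
      have := Real.mul_self_sqrt hn0.le
      symm
      calc 2 * t * √(n : ℝ) * (2 * t * √n) = 4 * t ^ 2 * (√n * √n) := by ring
        _ = m := by rw [this, ht2]; field_simp
    rw [this, hs, Real.sqrt_mul hc.le]
    field_simp
  have hterm : ∀ k ∈ Finset.range (n + 1), (phi q k n * s) ^ m ≤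
      Real.exp C * Real.exp (-((t * (k - n * q)) ^ 2)) + ((if k = 0 then 1 else 0)
        + (if k = n then 1 else 0)) := by
    intro k hk
    have hk := Finset.mem_range.1 hk
    have hpos : 0 < phi q k n * s := mul_pos (aux_phi_pos q hq0 hq1 k n (by omega)) hs0
    have hE : 0 < Real.exp C * Real.exp (-((t * (k - n * q)) ^ 2)) := by positivity
    by_cases k0 : k = 0
    · have : (phi q k n * s) ^ m ≤ 1 := by
        apply pow_le_one₀ hpos.le
        subst k0
        simpa [phi] using h0
      have h3 : (0 : ℝ) ≤ if k = n then 1 else 0 := by split_ifs <;> norm_num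
      rw [if_pos k0]
      linarith
    by_cases k1 : k = n
    · have : (phi q k n * s) ^ m ≤ 1 := by
        apply pow_le_one₀ hpos.le
        subst k1
        simpa [phi] using h1
      rw [if_neg k0, if_pos k1]
      linarith
    rw [if_neg k0, if_neg k1, add_zero, add_zero, ← Real.exp_add]
    have h2 := h k (by omega) (by omega)
    rw [← Real.exp_log hpos, ← Real.exp_nat_mul]
    apply Real.exp_le_exp.2
    have h3 : (m : ℝ) * Real.log (phi q k n * s) ≤ m * (C / n - (k - n * q) ^ 2 / (4 * n)) := by
      gcongr
    refine h3.trans ?_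
    have h4 : (m : ℝ) * (C / n) ≤ C := by
      rw [mul_div_assoc', div_le_iff₀ hn0]; nlinarith
    rw [mul_pow, ht2]
    have h5 : (m : ℝ) * (C / n - (k - n * q) ^ 2 / (4 * n)) = m * (C / n) - m / (4 * n) * (k - n * q) ^ 2 := by
      ring
    rw [h5]
    linarith
  have hsum := Finset.sum_le_sum hterm
  rw [Finset.sum_add_distrib, Finset.sum_add_distrib, ← Finset.mul_sum] at hsum
  have hg := aux_gauss t (n * q) ht0 ht1 n (by positivity) (by nlinarith)
  simp only [Finset.sum_ite_eq', Finset.mem_range] at hsum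
  rw [if_pos (by omega), if_pos (by omega)] at hsum
  have hg2 : Real.exp C * ∑ k ∈ Finset.range (n + 1), Real.exp (-((t * (k - n * q)) ^ 2))
      ≤ Real.exp C * (12 / t) := by gcongr
  have hS : (∑ k ∈ Finset.range (n + 1), phi q k n ^ m) * s ^ m
      ≤ Real.exp C * (12 / t) + 2 := by
    rw [Finset.sum_mul]
    simp_rw [← mul_pow]
    linarith
  rw [hr]
  calc _ ≤ (Real.exp C * (12 / t) + 2) * (t * (2 / √c)) := by gcongr
    _ = (12 * Real.exp C + 2 * t) * (2 / √c) := by field_simp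
    _ ≤ _ := by gcongr; linarith

lemma aux_final_lower (q s c D : ℝ) (hq0 : 0 < q) (hq1 : q < 1) (n m : ℕ) (hm : 1 ≤ m) (hmn : m ≤ n)
    (hc : 0 < c) (hs : s = √(c * n)) (hcq : c = 2 * Real.pi * q * (1 - q))
    (hD : D = 3 / q + 3 / (1 - q)) (hn : √(n : ℝ) ≤ n * (1 - q) / 2) :
    Real.exp (-(2 * D)) / (2 * √c) ≤
    (∑ k ∈ Finset.range (n + 1), phi q k n ^ m) * s ^ m * (√(m : ℝ) / s) := by
  have hp : 0 < 1 - q := by linarith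
  have hm0 : (0 : ℝ) < m := by exact_mod_cast hm
  have hm1 : (1 : ℝ) ≤ m := by exact_mod_cast hm
  have hmn' : (m : ℝ) ≤ n := by exact_mod_cast hmn
  have hn0 : (0 : ℝ) < n := by linarith
  have hs0 : 0 < s := by rw [hs]; positivity
  have hD0 : 0 < D := by rw [hD]; positivity
  obtain ⟨y, hy⟩ : ∃ y : ℝ, y = √(n / m) := ⟨_, rfl⟩
  have hy0 : 0 < y := by rw [hy]; positivity
  have hy2 : y ^ 2 = n / m := by rw [hy, Real.sq_sqrt (by positivity)]
  have hy1 : 1 ≤ y := by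
    rw [hy, Real.one_le_sqrt, one_le_div hm0]; exact hmn'
  have hyn : y ≤ √n := by
    rw [hy]; apply Real.sqrt_le_sqrt; exact div_le_self hn0.le hm1
  have hr : √(m : ℝ) / s = 1 / (y * √c) := by
    rw [hs, hy, Real.sqrt_mul hc.le, Real.sqrt_div hn0.le]
    field_simp
  obtain ⟨K, hK⟩ : ∃ K, K = ⌈(n * q : ℝ)⌉₊ := ⟨_, rfl⟩
  obtain ⟨M, hM⟩ : ∃ M, M = ⌊y⌋₊ := ⟨_, rfl⟩
  have hK1 : (n * q : ℝ) ≤ K := hK ▸ Nat.le_ceil _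
  have hK2 : (K : ℝ) < n * q + 1 := hK ▸ Nat.ceil_lt_add_one (by positivity)
  have hM1 : (M : ℝ) ≤ y := hM ▸ Nat.floor_le hy0.le
  have hM2 : y < M + 1 := hM ▸ Nat.lt_floor_add_one y
  have hM3 : 1 ≤ M := by rw [hM]; exact Nat.le_floor (by simpa using hy1)
  have hM3' : (1 : ℝ) ≤ M := by exact_mod_cast hM3
  have hk : ∀ k ∈ Finset.Ico K (K + M), k < n ∧ Real.exp (-(2 * D)) ≤ (phi q k n * s) ^ m := by
    intro k hk
    obtain ⟨ha, hb⟩ := Finset.mem_Ico.1 hk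
    have ha' : (K : ℝ) ≤ k := by exact_mod_cast ha
    have hb' : (k : ℝ) + 1 ≤ K + M := by exact_mod_cast hb
    have hx0 : 0 ≤ (k : ℝ) - n * q := by linarith
    have hxy : (k : ℝ) - n * q ≤ y := by linarith
    have hnq : 0 < n * q := by positivity
    have hnp : 0 < n * (1 - q) := by positivity
    have hkn : (k : ℝ) < n := by nlinarith
    have hkn2 : k < n := by exact_mod_cast hkn
    refine ⟨hkn2, ?_⟩
    have hk0 : (0 : ℝ) < k := by linarith
    have hk1 : 1 ≤ k := by exact_mod_cast hk0
    have hpos : 0 < phi q k n * s := mul_pos (aux_phi_pos q hq0 hq1 k n (by omega)) hs0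
    have hl := aux_lower q hq0 hq1 k (n - k) n hk1 (by omega) (by omega) (by linarith)
      (by rw [Nat.cast_sub hkn2.le]; linarith)
    rw [← hcq, ← hs, ← hD] at hl
    rw [← Real.exp_log hpos, ← Real.exp_nat_mul]
    apply Real.exp_le_exp.2
    have h3 : (m : ℝ) * (-(D * ((1 + (k - n * q) ^ 2) / n))) ≤ m * Real.log (phi q k n * s) := by
      gcongr
    refine le_trans ?_ h3
    have h4 : (k - n * q : ℝ) ^ 2 ≤ n / m := by rw [← hy2]; gcongr
    have h5 : (m : ℝ) * ((1 + (k - n * q) ^ 2) / n) ≤ 2 := by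
      rw [mul_div_assoc', div_le_iff₀ hn0]
      rw [le_div_iff₀ hm0] at h4
      linarith
    nlinarith
  have hsub : Finset.Ico K (K + M) ⊆ Finset.range (n + 1) := by
    intro k hk'
    have := (hk k hk').1
    exact Finset.mem_range.2 (by omega)
  have hS : M * Real.exp (-(2 * D)) ≤ (∑ k ∈ Finset.range (n + 1), phi q k n ^ m) * s ^ m := by
    rw [Finset.sum_mul]
    simp_rw [← mul_pow]
    have h1 := Finset.card_nsmul_le_sum (Finset.Ico K (K + M)) (fun k => (phi q k n * s) ^ m)
      (Real.exp (-(2 * D))) (fun k h => (hk k h).2)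
    have h2 := Finset.sum_le_sum_of_subset_of_nonneg (f := fun k => (phi q k n * s) ^ m) hsub
      (fun k h _ => pow_nonneg (mul_pos (aux_phi_pos q hq0 hq1 k n
        (by have := Finset.mem_range.1 h; omega)) hs0).le _)
    rw [Nat.card_Ico, nsmul_eq_mul, show K + M - K = M by omega] at h1
    exact h1.trans h2
  rw [hr]
  have hM4 : y / 2 ≤ M := by linarith
  calc _ = (y / 2 * Real.exp (-(2 * D))) * (1 / (y * √c)) := by field_simp
    _ ≤ (M * Real.exp (-(2 * D))) * (1 / (y * √c)) := by gcongr
    _ ≤ _ := by gcongr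

lemma aux_end (r c : ℝ) (hr : 0 < r) (hr1 : r < 1) :
    ∀ᶠ n : ℕ in Filter.atTop, r ^ n * √(c * n) ≤ 1 := by
  have h := (tendsto_self_mul_const_pow_of_lt_one hr.le hr1).const_mul (√c)
  rw [mul_zero] at h
  filter_upwards [h.eventually (ge_mem_nhds one_pos), Filter.eventually_ge_atTop 1] with n hn h1
  refine le_trans ?_ hn
  rw [Real.sqrt_mul' _ (Nat.cast_nonneg n)]
  have : √(n : ℝ) ≤ n := by
    have h1 : (1 : ℝ) ≤ n := by exact_mod_cast h1
    rw [Real.sqrt_le_left (by positivity)]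
    nlinarith
  calc r ^ n * (√c * √n) ≤ r ^ n * (√c * n) := by gcongr
    _ = _ := by ring

/-- Proposition 4.3 (Θ-estimate): if m(n) ≥ 1 and m(n) = O(√n), then
∑_{k=0}^n φ_q(k,n)^{m(n)} = Θ((2πq(1−q)n)^{−(m(n)−1)/2} / √(m(n))). -/
theorem sum_phi_pow_theta (q : ℝ) (hq0 : 0 < q) (hq1 : q < 1) (m : ℕ → ℕ)
    (hm1 : ∀ n, 1 ≤ m n)
    (hm : ∃ A : ℝ, ∀ᶠ n in Filter.atTop, (m n : ℝ) ≤ A * Real.sqrt n) :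
    ∃ C₁ > (0 : ℝ), ∃ C₂ > (0 : ℝ), ∃ N : ℕ, ∀ n : ℕ, n > N →
      C₁ ≤ (∑ k ∈ Finset.range (n + 1), phi q k n ^ m n) *
            (2 * Real.pi * q * (1 - q) * n) ^ (((m n : ℝ) - 1) / 2) *
            Real.sqrt (m n) ∧
      (∑ k ∈ Finset.range (n + 1), phi q k n ^ m n) *
            (2 * Real.pi * q * (1 - q) * n) ^ (((m n : ℝ) - 1) / 2) *
            Real.sqrt (m n) ≤ C₂ := by
  obtain ⟨A, hA⟩ := hm
  have hp : 0 < 1 - q := by linarith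
  obtain ⟨c, hcq⟩ : ∃ c, c = 2 * Real.pi * q * (1 - q) := ⟨_, rfl⟩
  have hc : 0 < c := by rw [hcq]; have := Real.pi_pos; positivity
  obtain ⟨C, hC, N, hN⟩ := aux_upper q hq0 hq1
  obtain ⟨D, hD⟩ : ∃ D, D = 3 / q + 3 / (1 - q) := ⟨_, rfl⟩
  have hsq : Filter.Tendsto (fun n : ℕ => √(n : ℝ)) Filter.atTop Filter.atTop :=
    Real.tendsto_sqrt_atTop.comp tendsto_natCast_atTop_atTop
  have hev : ∀ᶠ n : ℕ in Filter.atTop,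
      Real.exp (-(2 * D)) / (2 * √c) ≤ (∑ k ∈ Finset.range (n + 1), phi q k n ^ m n) *
            (c * n) ^ (((m n : ℝ) - 1) / 2) * Real.sqrt (m n) ∧
      (∑ k ∈ Finset.range (n + 1), phi q k n ^ m n) *
            (c * n) ^ (((m n : ℝ) - 1) / 2) * Real.sqrt (m n) ≤ (12 * Real.exp C + 2) * (2 / √c) := by
    filter_upwards [hA, hsq.eventually_ge_atTop A, hsq.eventually_ge_atTop (2 / (1 - q)),
      aux_end q c hq0 hq1, aux_end (1 - q) c hp (by linarith), Filter.eventually_ge_atTop N,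
      Filter.eventually_ge_atTop 1] with n e1 e2 e3 e4 e5 e6 e7
    have hn0 : (0 : ℝ) < n := by exact_mod_cast e7
    have hss := Real.mul_self_sqrt hn0.le
    have hs0 := Real.sqrt_nonneg (n : ℝ)
    have hmn : m n ≤ n := by
      have : (m n : ℝ) ≤ n := by nlinarith
      exact_mod_cast this
    have hsn : √(n : ℝ) ≤ n * (1 - q) / 2 := by
      rw [div_le_iff₀ hp] at e3
      nlinarith
    rw [aux_factor _ c _ n (m n) hc hn0 rfl]
    refine ⟨aux_final_lower q _ c D hq0 hq1 n (m n) (hm1 n) hmn hc rfl hcq hD hsn,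
      aux_final_upper q C _ c hq0 hq1 n (m n) (hm1 n) hmn hC hc rfl ?_ e5 e4⟩
    intro k hk hkn
    have := hN n e6 k hk hkn
    rwa [← hcq] at this
  obtain ⟨N0, hN0⟩ := Filter.eventually_atTop.1 hev
  rw [← hcq]
  exact ⟨_, by positivity, _, by positivity, N0, fun n hn => hN0 n hn.le⟩
end
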